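/- arXiv:1310.2336 — 6 statements merged into one kernel-verified Lean document; each statement's English description precedes it below -/
import Mathlib

section
/- If |E(G_n)|/c(n) → 0 in probability, then the number of monochromatic edges N(G_n) → 0 in probability; and if |E(G_n)|/c(n) → ∞ in probability, then N(G_n) → ∞ in probability. -/
open MeasureTheory ProbabilityTheory Filter SimpleGraph
open scoped ENNReal NNReal Topology BoundedContinuousFunction

instance (n : ℕ) : MeasurableSpace (SimpleGraph (Fin n)) := ⊤

/-- The number of edges of a simple graph. -/
noncomputable def eCount {V : Type*} (G : SimpleGraph V) : ℕ := Nat.card G.edgeSet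

/-- The number of monochromatic edges of a graph under a coloring. -/
noncomputable def monoCount {n c : ℕ} (G : SimpleGraph (Fin n)) (Y : Fin n → Fin c) : ℕ :=
  Nat.card {e : Sym2 (Fin n) // e ∈ G.edgeSet ∧ (e.map Y).IsDiag}

/-- The uniform distribution on `Fin m`. -/
noncomputable def uniformFin (m : ℕ) : Measure (Fin m) := (m : ℝ≥0∞)⁻¹ • Measure.count

/-- Removing one coordinate. -/
theorem key_sum {n c : ℕ} (f : (Fin n → Fin c) → ℝ) (p q : Fin n) (hpq : p ≠ q)
    (hf : ∀ y k, f (Function.update y q k) = f y) :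
    (c : ℝ) * ∑ y, (if y p = y q then f y else 0) = ∑ y, f y := by
  classical
  rw [← Finset.sum_filter]
  have h : ∑ x ∈ (Finset.univ.filter (fun y : Fin n → Fin c => y p = y q)) ×ˢ
      (Finset.univ : Finset (Fin c)), f x.1 = ∑ y, f y := by
    refine Finset.sum_nbij' (fun x => Function.update x.1 q x.2)
      (fun y => (Function.update y q (y p), y q)) ?_ ?_ ?_ ?_ ?_
    · intro a _; simp
    · intro a _; simp [Function.update_of_ne hpq]
    · rintro ⟨y, k⟩ h
      simp at h
      simp [Function.update_of_ne hpq, h]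
    · intro a _; simp
    · intro a _; simp [hf]
  rw [← h, Finset.sum_product]
  simp [Finset.mul_sum]

open Classical in
/-- Monochromatic indicator. -/
noncomputable def monoInd {n c : ℕ} (e : Sym2 (Fin n)) (y : Fin n → Fin c) : ℝ :=
  if (e.map y).IsDiag then 1 else 0

theorem monoInd_mk {n c : ℕ} (a b : Fin n) (y : Fin n → Fin c) :
    monoInd s(a, b) y = if y a = y b then 1 else 0 := by
  simp [monoInd]

theorem sum_monoInd {n c : ℕ} (e : Sym2 (Fin n)) (he : ¬ e.IsDiag) :
    (c : ℝ) * ∑ y : Fin n → Fin c, monoInd e y = (c : ℝ) ^ n := by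
  induction e with
  | _ a b =>
    simp only [monoInd_mk]
    rw [key_sum (fun _ => 1) a b (by simpa using he) (by simp)]
    simp

theorem sum_monoInd_mul_aux {n c : ℕ} (e : Sym2 (Fin n)) (he : ¬ e.IsDiag) (p q : Fin n)
    (hpq : p ≠ q) (hq : q ∉ e) :
    (c : ℝ) ^ 2 * ∑ y : Fin n → Fin c, monoInd e y * monoInd s(p, q) y = (c : ℝ) ^ n := by
  rw [← sum_monoInd e he, ← key_sum (monoInd e) p q hpq]
  · simp only [monoInd_mk, mul_ite, mul_one, mul_zero]
    ring
  · intro y k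
    induction e with
    | _ a b =>
      simp at hq
      simp [monoInd_mk, Function.update_of_ne (Ne.symm hq.1), Function.update_of_ne (Ne.symm hq.2)]

theorem sum_monoInd_mul {n c : ℕ} (e e' : Sym2 (Fin n)) (he : ¬ e.IsDiag) (he' : ¬ e'.IsDiag)
    (hne : e ≠ e') :
    (c : ℝ) ^ 2 * ∑ y : Fin n → Fin c, monoInd e y * monoInd e' y = (c : ℝ) ^ n := by
  induction e' with
  | _ p q =>
    have hpq : p ≠ q := by simpa using he'
    by_cases hq : q ∈ e
    · by_cases hp : p ∈ e
      · exact absurd ((Sym2.mem_and_mem_iff hpq).1 ⟨hp, hq⟩) hne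
      · rw [Sym2.eq_swap]
        exact sum_monoInd_mul_aux e he q p hpq.symm hp
    · exact sum_monoInd_mul_aux e he p q hpq hq

theorem monoInd_sq {n c : ℕ} (e : Sym2 (Fin n)) (y : Fin n → Fin c) :
    monoInd e y * monoInd e y = monoInd e y := by
  unfold monoInd; split_ifs <;> simp

open Classical in
theorem monoCount_eq_sum {n c : ℕ} (G : SimpleGraph (Fin n)) (y : Fin n → Fin c) :
    (monoCount G y : ℝ) = ∑ e ∈ G.edgeFinset, monoInd e y := by
  unfold monoCount monoInd
  rw [Finset.sum_boole, Nat.card_eq_fintype_card, Fintype.card_subtype]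
  congr 2
  ext e
  simp

open Classical in
theorem eCount_eq {n : ℕ} (G : SimpleGraph (Fin n)) : eCount G = G.edgeFinset.card := by
  unfold eCount
  rw [Nat.card_eq_fintype_card, SimpleGraph.edgeFinset_card]

theorem first_moment {n c : ℕ} (hc : 2 ≤ c) (G : SimpleGraph (Fin n)) :
    ∑ y : Fin n → Fin c, (monoCount G y : ℝ) = (eCount G : ℝ) / c * (c : ℝ) ^ n := by
  classical
  have hc0 : (c : ℝ) ≠ 0 := by positivity
  simp only [monoCount_eq_sum, eCount_eq]
  rw [Finset.sum_comm, Finset.sum_congr rfl (g := fun _ => (c : ℝ) ^ n / c)]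
  · simp; ring
  · intro e he
    rw [eq_div_iff hc0, mul_comm]
    exact sum_monoInd e (G.not_isDiag_of_mem_edgeFinset he)

theorem second_moment {n c : ℕ} (hc : 2 ≤ c) (G : SimpleGraph (Fin n)) :
    ∑ y : Fin n → Fin c, (monoCount G y : ℝ) ^ 2
      ≤ ((eCount G : ℝ) / c + ((eCount G : ℝ) / c) ^ 2) * (c : ℝ) ^ n := by
  classical
  have hc0 : (c : ℝ) ≠ 0 := by positivity
  have h1 : ∑ y : Fin n → Fin c, (monoCount G y : ℝ) ^ 2 =
      ∑ e ∈ G.edgeFinset, ∑ e' ∈ G.edgeFinset, ∑ y : Fin n → Fin c, monoInd e y * monoInd e' y := by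
    simp only [monoCount_eq_sum, sq, Finset.sum_mul_sum]
    rw [Finset.sum_comm]
    refine Finset.sum_congr rfl fun e _ => ?_
    rw [Finset.sum_comm]
  rw [h1]
  have h2 : ∀ e ∈ G.edgeFinset, ∀ e' ∈ G.edgeFinset,
      ∑ y : Fin n → Fin c, monoInd e y * monoInd e' y ≤
        (if e = e' then (c : ℝ) ^ n / c else 0) + (c : ℝ) ^ n / c ^ 2 := by
    intro e he e' he'
    split_ifs with h
    · subst h
      simp only [monoInd_sq]
      have := sum_monoInd (c := c) e (G.not_isDiag_of_mem_edgeFinset he)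
      have h3 : ∑ y : Fin n → Fin c, monoInd e y = (c : ℝ) ^ n / c := by
        rw [eq_div_iff hc0, mul_comm]; exact this
      rw [h3]
      have : (0 : ℝ) ≤ (c : ℝ) ^ n / c ^ 2 := by positivity
      linarith
    · have := sum_monoInd_mul (c := c) e e' (G.not_isDiag_of_mem_edgeFinset he)
        (G.not_isDiag_of_mem_edgeFinset he') h
      rw [zero_add, le_div_iff₀ (by positivity), mul_comm, this]
  refine (Finset.sum_le_sum fun e he => Finset.sum_le_sum fun e' he' => h2 e he e' he').trans ?_
  simp only [Finset.sum_add_distrib, Finset.sum_ite_eq, eCount_eq]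
  rw [Finset.sum_congr rfl (g := fun _ => (c : ℝ) ^ n / c) (fun e he => by rw [if_pos he])]
  simp
  apply le_of_eq
  field_simp

theorem chebyshev_sum {n c : ℕ} (hc : 2 ≤ c) (G : SimpleGraph (Fin n)) :
    ∑ y : Fin n → Fin c, ((monoCount G y : ℝ) - (eCount G : ℝ) / c) ^ 2
      ≤ (eCount G : ℝ) / c * (c : ℝ) ^ n := by
  have h1 := first_moment hc G
  have h2 := second_moment hc G
  set l := (eCount G : ℝ) / c
  have : ∑ y : Fin n → Fin c, ((monoCount G y : ℝ) - l) ^ 2 =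
      ∑ y : Fin n → Fin c, (monoCount G y : ℝ) ^ 2 - 2 * l * ∑ y : Fin n → Fin c, (monoCount G y : ℝ)
        + (c : ℝ) ^ n * l ^ 2 := by
    rw [Finset.mul_sum, ← Finset.sum_sub_distrib]
    have : (c : ℝ) ^ n * l ^ 2 = ∑ y : Fin n → Fin c, l ^ 2 := by simp
    rw [this, ← Finset.sum_add_distrib]
    exact Finset.sum_congr rfl fun y _ => by ring
  rw [this, h1]
  nlinarith

theorem uniformFin_prob {c : ℕ} (hc : 2 ≤ c) : IsProbabilityMeasure (uniformFin c) := by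
  constructor
  simp only [uniformFin, Measure.smul_apply, smul_eq_mul]
  rw [Measure.count_apply_finite' Set.finite_univ MeasurableSet.univ]
  simp
  refine ENNReal.inv_mul_cancel ?_ (by simp)
  simp; omega

open Classical in
theorem pi_le {n c : ℕ} (hc : 2 ≤ c) (A : Set (Fin n → Fin c)) (f : (Fin n → Fin c) → ℝ) (b δ : ℝ)
    (hb : 0 < b) (hf0 : ∀ y, 0 ≤ f y) (hf : ∀ y ∈ A, b ≤ f y)
    (hs : ∑ y, f y ≤ δ * b * (c : ℝ) ^ n) :
    (Measure.pi fun _ : Fin n => uniformFin c) A ≤ ENNReal.ofReal δ := by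
  have := uniformFin_prob hc
  have hA : (Measure.pi fun _ : Fin n => uniformFin c) A
      = ∑ y ∈ A.toFinset, (Measure.pi fun _ : Fin n => uniformFin c) {y} := by
    rw [sum_measure_singleton]; simp
  have hsing : ∀ y : Fin n → Fin c, (Measure.pi fun _ : Fin n => uniformFin c) {y}
      = ENNReal.ofReal (((c : ℝ) ^ n)⁻¹) := by
    intro y
    rw [Measure.pi_singleton]
    simp only [uniformFin, Measure.smul_apply, smul_eq_mul, Measure.count_singleton, mul_one]
    rw [ENNReal.ofReal_inv_of_pos (by positivity), ENNReal.ofReal_pow (by positivity)]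
    simp [ENNReal.inv_pow]
  rw [hA]
  simp only [hsing]
  rw [← ENNReal.ofReal_sum_of_nonneg (fun _ _ => by positivity)]
  apply ENNReal.ofReal_le_ofReal
  have h1 : (A.toFinset.card : ℝ) * b ≤ δ * b * (c : ℝ) ^ n := by
    refine le_trans ?_ hs
    calc (A.toFinset.card : ℝ) * b = ∑ y ∈ A.toFinset, b := by simp
      _ ≤ ∑ y ∈ A.toFinset, f y := Finset.sum_le_sum fun y hy => hf y (by simpa using hy)
      _ ≤ ∑ y, f y := Finset.sum_le_univ_sum_of_nonneg hf0
  simp only [Finset.sum_const, nsmul_eq_mul]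
  rw [← div_eq_mul_inv, div_le_iff₀ (by positivity)]
  exact le_of_mul_le_mul_right (by linarith) hb

theorem joint_le {n c : ℕ} (hc : 2 ≤ c) {Ω : Type} [MeasurableSpace Ω] (P : Measure Ω)
    [IsProbabilityMeasure P] (G : Ω → SimpleGraph (Fin n)) (Y : Ω → (Fin n → Fin c))
    (hmeas : Measurable (fun ω => (G ω, Y ω)))
    (hjoint : Measure.map (fun ω => (G ω, Y ω)) P
      = (Measure.map G P).prod (Measure.pi fun _ : Fin n => uniformFin c))
    (B : SimpleGraph (Fin n) → Prop) (A : SimpleGraph (Fin n) → (Fin n → Fin c) → Prop)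
    (δ : ℝ) (hδ : 0 ≤ δ)
    (h : ∀ g, ¬ B g → (Measure.pi fun _ : Fin n => uniformFin c) {y | A g y} ≤ ENNReal.ofReal δ) :
    (P {ω | A (G ω) (Y ω)}).toReal ≤ (P {ω | B (G ω)}).toReal + δ := by
  have := uniformFin_prob hc
  have hG : Measurable G := measurable_fst.comp hmeas
  have : IsProbabilityMeasure (Measure.map G P) := Measure.isProbabilityMeasure_map hG.aemeasurable
  have : Countable (SimpleGraph (Fin n)) := Finite.to_countable
  have : DiscreteMeasurableSpace (SimpleGraph (Fin n)) := ⟨fun _ => trivial⟩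
  have hmA : MeasurableSet {x : SimpleGraph (Fin n) × (Fin n → Fin c) | A x.1 x.2} :=
    MeasurableSet.of_discrete
  have h1 : P {ω | A (G ω) (Y ω)} = Measure.map (fun ω => (G ω, Y ω)) P {x | A x.1 x.2} := by
    rw [Measure.map_apply hmeas hmA]; rfl
  have h2 : P {ω | B (G ω)} = Measure.map G P {g | B g} := by
    rw [Measure.map_apply hG MeasurableSet.of_discrete]; rfl
  have h3 : P {ω | A (G ω) (Y ω)} ≤ P {ω | B (G ω)} + ENNReal.ofReal δ := by
    rw [h1, hjoint, h2, Measure.prod_apply hmA]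
    calc _ ≤ ∫⁻ g, (Set.indicator {g | B g} (fun _ => (1 : ℝ≥0∞)) g + ENNReal.ofReal δ)
          ∂(Measure.map G P) := by
          refine lintegral_mono fun g => ?_
          by_cases hg : B g
          · refine prob_le_one.trans ?_
            simp [hg]
          · simpa [hg] using h g hg
      _ = _ := by
          rw [lintegral_add_right _ measurable_const,
            lintegral_indicator_const MeasurableSet.of_discrete]
          simp
  have h4 := ENNReal.toReal_mono (by finiteness) h3
  rwa [ENNReal.toReal_add (by finiteness) (by finiteness), ENNReal.toReal_ofReal hδ] at h4

theorem tendsto_of_bound (u : ℕ → ℝ) (hu : ∀ n, 0 ≤ u n)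
    (h : ∀ δ : ℝ, 0 < δ → ∃ v : ℕ → ℝ, Tendsto v atTop (𝓝 0) ∧ ∀ n, u n ≤ v n + δ) :
    Tendsto u atTop (𝓝 0) := by
  rw [Metric.tendsto_atTop]
  intro ε hε
  obtain ⟨v, hv, hb⟩ := h (ε / 2) (by positivity)
  obtain ⟨N, hN⟩ := (Metric.tendsto_atTop.1 hv) (ε / 2) (by positivity)
  refine ⟨N, fun n hn => ?_⟩
  have h1 := hN n hn
  rw [Real.dist_eq, sub_zero] at h1 ⊢
  rw [abs_of_nonneg (hu n)]
  linarith [le_abs_self (v n), hb n]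

/-- If |E(G_n)|/c(n) → 0 in probability then N(G_n) → 0 in probability, and if
|E(G_n)|/c(n) → ∞ in probability then N(G_n) → ∞ in probability. -/
theorem stmt1
    (Ω : ℕ → Type) [∀ n, MeasurableSpace (Ω n)]
    (P : ∀ n, Measure (Ω n)) [∀ n, IsProbabilityMeasure (P n)]
    (c : ℕ → ℕ) (hc : ∀ n, 2 ≤ c n)
    (G : ∀ n, Ω n → SimpleGraph (Fin n))
    (Y : ∀ n, Ω n → (Fin n → Fin (c n)))
    (hmeas : ∀ n, Measurable (fun ω => (G n ω, Y n ω)))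
    -- the graph is independent of the colors, and the colors are i.i.d. uniform:
    (hjoint : ∀ n, Measure.map (fun ω => (G n ω, Y n ω)) (P n)
      = (Measure.map (G n) (P n)).prod (Measure.pi fun _ : Fin n => uniformFin (c n))) :
    -- if |E(G_n)|/c(n) → 0 in probability then N(G_n) → 0 in probability:
    ((∀ ε : ℝ, 0 < ε →
        Tendsto (fun n => ((P n) {ω | ε ≤ (eCount (G n ω) : ℝ) / (c n : ℝ)}).toReal) atTop (𝓝 0)) →
      ∀ ε : ℝ, 0 < ε →
        Tendsto (fun n => ((P n) {ω | ε ≤ (monoCount (G n ω) (Y n ω) : ℝ)}).toReal) atTop (𝓝 0))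
    ∧
    -- if |E(G_n)|/c(n) → ∞ in probability then N(G_n) → ∞ in probability:
    ((∀ M : ℝ,
        Tendsto (fun n => ((P n) {ω | (eCount (G n ω) : ℝ) / (c n : ℝ) ≤ M}).toReal) atTop (𝓝 0)) →
      ∀ M : ℝ,
        Tendsto (fun n => ((P n) {ω | (monoCount (G n ω) (Y n ω) : ℝ) ≤ M}).toReal) atTop (𝓝 0)) := by
  constructor
  · intro H ε hε
    refine tendsto_of_bound _ (fun n => ENNReal.toReal_nonneg) fun δ hδ => ?_
    refine ⟨_, H (δ * ε) (by positivity), fun n => ?_⟩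
    refine joint_le (hc n) (P n) (G n) (Y n) (hmeas n) (hjoint n)
      (fun g => δ * ε ≤ (eCount g : ℝ) / (c n : ℝ)) (fun g y => ε ≤ (monoCount g y : ℝ)) δ hδ.le ?_
    intro g hg
    refine pi_le (hc n) _ (fun y => (monoCount g y : ℝ)) ε δ hε (fun y => by positivity)
      (fun y hy => hy) ?_
    rw [first_moment (hc n) g]
    exact mul_le_mul_of_nonneg_right (not_le.1 hg).le (by positivity)
  · intro H M
    refine tendsto_of_bound _ (fun n => ENNReal.toReal_nonneg) fun δ hδ => ?_
    refine ⟨_, H (max (2 * M) (4 / δ)), fun n => ?_⟩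
    refine joint_le (hc n) (P n) (G n) (Y n) (hmeas n) (hjoint n)
      (fun g => (eCount g : ℝ) / (c n : ℝ) ≤ max (2 * M) (4 / δ))
      (fun g y => (monoCount g y : ℝ) ≤ M) δ hδ.le ?_
    intro g hg
    rw [not_le, max_lt_iff] at hg
    obtain ⟨hg1, hg2⟩ := hg
    have hs := chebyshev_sum (hc n) g
    set l := (eCount g : ℝ) / (c n : ℝ)
    have hl : 0 < l := lt_trans (by positivity) hg2
    refine pi_le (hc n) _ (fun y => ((monoCount g y : ℝ) - l) ^ 2) (l ^ 2 / 4) δ (by positivity)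
      (fun y => by positivity) (fun y hy => ?_) (hs.trans ?_)
    · have hy' : (monoCount g y : ℝ) ≤ M := hy
      nlinarith
    · refine mul_le_mul_of_nonneg_right ?_ (by positivity)
      rw [div_lt_iff₀ hδ] at hg2
      nlinarith
end

section
/- Suppose c(n) → ∞ and |E(G_n)|/c(n) → ∞ in probability as n → ∞. Then (N(G_n) − |E(G_n)|/c(n)) / √(|E(G_n)|/c(n)) converges in distribution to the standard normal distribution N(0,1). -/
open MeasureTheory ProbabilityTheory Filter SimpleGraph
open scoped ENNReal NNReal Topology BoundedContinuousFunction

set_option linter.unusedSectionVars false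

section Aux
open Finset BigOperators

variable {V C : Type*} [Fintype V] [DecidableEq V] [Fintype C] [DecidableEq C] [Nonempty C]

noncomputable def pp (C : Type*) [Fintype C] : ℝ := ((Fintype.card C : ℕ) : ℝ)⁻¹

lemma pp_pos : 0 < pp C := by
  unfold pp
  have : 0 < Fintype.card C := Fintype.card_pos
  positivity

lemma pp_le_one : pp C ≤ 1 := by
  unfold pp
  have : 1 ≤ Fintype.card C := Fintype.card_pos
  exact inv_le_one_of_one_le₀ (by exact_mod_cast this)

noncomputable def XX (y : V → C) (i j : V) : ℝ := (if y i = y j then 1 else 0) - pp C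

lemma XX_comm (y : V → C) (i j : V) : XX y i j = XX y j i := by
  unfold XX
  simp [eq_comm]

lemma expect_update {E : Type*} [AddCommGroup E] [Module ℚ≥0 E] (k : V) (F : (V → C) → E) :
    𝔼 y, F y = 𝔼 y, 𝔼 a : C, F (Function.update y k a) := by
  classical
  have h1 : 𝔼 y, F y = 𝔼 y : V → C, 𝔼 a : C, F y := by
    refine Finset.expect_congr rfl fun y _ => ?_
    rw [Fintype.expect_const]
  rw [h1, ← Finset.expect_product' univ univ (fun y _ => F y),
    ← Finset.expect_product' univ univ (fun y a => F (Function.update y k a))]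
  refine Finset.expect_nbij' (fun x => (Function.update x.1 k x.2, x.1 k))
    (fun x => (Function.update x.1 k x.2, x.1 k)) ?_ ?_ ?_ ?_ ?_ <;> simp

lemma q0 (b : C) : 𝔼 a : C, (if a = b then (1:ℝ) else 0) = pp C := by
  rw [Fintype.expect_eq_sum_div_card]
  simp [pp]

lemma q1 (b : C) : 𝔼 a : C, ((if a = b then (1:ℝ) else 0) - pp C) = 0 := by
  rw [Finset.expect_sub_distrib, q0, Fintype.expect_const, sub_self]

lemma q2 (b b' : C) : 𝔼 a : C, ((if a = b then (1:ℝ) else 0) - pp C) *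
    ((if a = b' then (1:ℝ) else 0) - pp C) = pp C * ((if b = b' then (1:ℝ) else 0) - pp C) := by
  have h : ∀ a : C, ((if a = b then (1:ℝ) else 0) - pp C) *
    ((if a = b' then (1:ℝ) else 0) - pp C) = (if a = b then (1:ℝ) else 0) *
      ((if b = b' then (1:ℝ) else 0) - pp C) - pp C * ((if a = b' then (1:ℝ) else 0) - pp C) := by
    intro a
    by_cases h : a = b
    · subst h; simp; ring
    · simp [h]
  simp_rw [h]
  rw [Finset.expect_sub_distrib, ← Finset.expect_mul, q0, ← Finset.mul_expect, q1]
  ring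

lemma q3 : ∃ κ : ℝ, ∀ b : C, 𝔼 a : C, ((if a = b then (1:ℝ) else 0) - pp C) ^ 3 = κ := by
  refine ⟨pp C * (1 - 3 * pp C + 3 * pp C ^ 2) - pp C ^ 3, fun b => ?_⟩
  have h : ∀ a : C, ((if a = b then (1:ℝ) else 0) - pp C) ^ 3 = (if a = b then (1:ℝ) else 0) *
      (1 - 3 * pp C + 3 * pp C ^ 2) - pp C ^ 3 := by
    intro a
    by_cases h : a = b
    · simp [h]; ring
    · simp [h]; ring
  simp_rw [h]
  rw [Finset.expect_sub_distrib, ← Finset.expect_mul, q0, Fintype.expect_const]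

lemma q4 (b : C) : 𝔼 a : C, ((if a = b then (1:ℝ) else 0) - pp C) ^ 4 ≤ pp C := by
  have hp := pp_pos (C := C)
  have hp1 := pp_le_one (C := C)
  calc 𝔼 a : C, ((if a = b then (1:ℝ) else 0) - pp C) ^ 4
      ≤ 𝔼 a : C, ((if a = b then (1:ℝ) else 0) - pp C) * ((if a = b then (1:ℝ) else 0) - pp C) := by
        refine Finset.expect_le_expect fun a _ => ?_
        have h1 : ((if a = b then (1:ℝ) else 0) - pp C) ^ 2 ≤ 1 := by
          split_ifs <;> nlinarith
        nlinarith [sq_nonneg ((if a = b then (1:ℝ) else 0) - pp C)]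
    _ ≤ pp C := by rw [q2]; simp; nlinarith

noncomputable def DD (k : V) (B : Finset V) (y : V → C) : ℝ := ∑ j ∈ B, XX y k j

noncomputable def TT (B : Finset V) (y : V → C) : ℝ := ∑ i ∈ B, ∑ j ∈ B, XX y i j

lemma XX_update {k i j : V} (hi : i ≠ k) (hj : j ≠ k) (y : V → C) (a : C) :
    XX (Function.update y k a) i j = XX y i j := by
  simp [XX, hi, hj]

lemma XX_update_self {k j : V} (hj : j ≠ k) (y : V → C) (a : C) :
    XX (Function.update y k a) k j = (if a = y j then 1 else 0) - pp C := by
  simp [XX, hj]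

lemma TT_update {k : V} {B : Finset V} (hk : k ∉ B) (y : V → C) (a : C) :
    TT B (Function.update y k a) = TT B y := by
  unfold TT
  refine Finset.sum_congr rfl fun i hi => Finset.sum_congr rfl fun j hj => ?_
  exact XX_update (by rintro rfl; exact hk hi) (by rintro rfl; exact hk hj) y a

lemma DD_update' {k l : V} {B : Finset V} (hk : k ∉ B) (hl : l ≠ k) (y : V → C) (a : C) :
    DD l B (Function.update y k a) = DD l B y := by
  unfold DD
  refine Finset.sum_congr rfl fun i hi => ?_
  exact XX_update hl (by rintro rfl; exact hk hi) y a

lemma avg_DD {k : V} {B : Finset V} (hk : k ∉ B) (y : V → C) :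
    𝔼 a : C, DD k B (Function.update y k a) = 0 := by
  unfold DD
  rw [Finset.expect_sum_comm]
  refine Finset.sum_eq_zero fun j hj => ?_
  simp_rw [XX_update_self (show j ≠ k by rintro rfl; exact hk hj)]
  exact q1 _

lemma avg_DD_sq {k : V} {B : Finset V} (hk : k ∉ B) (y : V → C) :
    𝔼 a : C, DD k B (Function.update y k a) ^ 2 = pp C * TT B y := by
  unfold DD TT
  simp_rw [sq, Finset.sum_mul_sum]
  rw [Finset.expect_sum_comm, Finset.mul_sum]
  refine Finset.sum_congr rfl fun i hi => ?_
  rw [Finset.expect_sum_comm, Finset.mul_sum]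
  refine Finset.sum_congr rfl fun j hj => ?_
  simp_rw [XX_update_self (show i ≠ k by rintro rfl; exact hk hi),
    XX_update_self (show j ≠ k by rintro rfl; exact hk hj)]
  exact q2 _ _

/-- Integrating out coordinate `k`. -/
lemma expect_mul_avg {K : Type*} [Field K] [CharZero K] {k : V} (F H H' : (V → C) → K)
    (hF : ∀ y a, F (Function.update y k a) = F y)
    (hH : ∀ y, 𝔼 a : C, H (Function.update y k a) = H' y) :
    𝔼 y, F y * H y = 𝔼 y, F y * H' y := by
  rw [expect_update k]
  refine Finset.expect_congr rfl fun y _ => ?_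
  simp_rw [hF]
  rw [← Finset.mul_expect, hH]

lemma TT_insert {k : V} {B : Finset V} (hk : k ∉ B) (y : V → C) :
    TT (insert k B) y = TT B y + 2 * DD k B y + (1 - pp C) := by
  unfold TT DD
  rw [Finset.sum_insert hk]
  simp_rw [Finset.sum_insert hk]
  rw [Finset.sum_add_distrib]
  have : ∑ x ∈ B, XX y x k = ∑ x ∈ B, XX y k x := Finset.sum_congr rfl fun j _ => XX_comm _ _ _
  rw [this]
  have : XX y k k = 1 - pp C := by simp [XX]
  rw [this]; ring

lemma expect_DD {k : V} {B : Finset V} (hk : k ∉ B) : 𝔼 y : V → C, DD k B y = 0 := by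
  rw [expect_update k]
  simp_rw [avg_DD hk]
  simp

lemma expect_TT (B : Finset V) : 𝔼 y : V → C, TT B y = #B * (1 - pp C) := by
  induction B using Finset.induction_on with
  | empty => simp [TT]
  | insert k B hk ih =>
    simp_rw [TT_insert hk]
    rw [Finset.expect_add_distrib, Finset.expect_add_distrib, ih, ← Finset.mul_expect, expect_DD hk,
      Fintype.expect_const, Finset.card_insert_of_notMem hk]
    push_cast; ring

lemma expect_DD_sq {k : V} {B : Finset V} (hk : k ∉ B) :
    𝔼 y : V → C, DD k B y ^ 2 = pp C * (#B * (1 - pp C)) := by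
  rw [expect_update k]
  simp_rw [avg_DD_sq hk]
  rw [← Finset.mul_expect, expect_TT]

lemma expect_TT_var (B : Finset V) :
    𝔼 y : V → C, (TT B y - #B * (1 - pp C)) ^ 2 ≤ 2 * #B ^ 2 * pp C := by
  have hp := pp_pos (C := C)
  have hp1 := pp_le_one (C := C)
  induction B using Finset.induction_on with
  | empty => simp [TT]
  | insert k B hk ih =>
    have h : ∀ y : V → C, (TT (insert k B) y - #(insert k B) * (1 - pp C)) ^ 2 =
        (TT B y - #B * (1 - pp C)) ^ 2 + 4 * ((TT B y - #B * (1 - pp C)) * DD k B y)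
          + 4 * DD k B y ^ 2 := by
      intro y
      rw [TT_insert hk, Finset.card_insert_of_notMem hk]
      push_cast; ring
    simp_rw [h]
    rw [Finset.expect_add_distrib, Finset.expect_add_distrib, ← Finset.mul_expect,
      ← Finset.mul_expect, expect_DD_sq hk,
      expect_mul_avg (k := k) (fun y => TT B y - #B * (1 - pp C)) (DD k B) (fun _ => 0)
        (fun y a => by simp [TT_update hk]) (fun y => avg_DD hk y),
      Finset.card_insert_of_notMem hk]
    push_cast
    simp only [mul_zero, Finset.expect_const_zero, add_zero]
    have : (0:ℝ) ≤ #B := by positivity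
    nlinarith [mul_nonneg (mul_nonneg this hp.le) hp.le]

lemma expect_DD_four {k : V} {B : Finset V} (hk : k ∉ B) :
    𝔼 y : V → C, DD k B y ^ 4 ≤ #B * pp C + 3 * #B ^ 2 * pp C ^ 2 := by
  have hp := pp_pos (C := C)
  have hp1 := pp_le_one (C := C)
  induction B using Finset.induction_on with
  | empty => simp [DD]
  | insert l B hl ih =>
    have hk' : k ∉ B := fun h => hk (Finset.mem_insert_of_mem h)
    have hkl : k ≠ l := by rintro rfl; exact hk (Finset.mem_insert_self _ _)
    obtain ⟨κ, hκ⟩ := q3 (C := C)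
    have h : ∀ y : V → C, DD k (insert l B) y ^ 4 = DD k B y ^ 4 + 4 * (DD k B y ^ 3 * XX y k l)
        + 6 * (DD k B y ^ 2 * XX y k l ^ 2) + 4 * (DD k B y * XX y k l ^ 3) + XX y k l ^ 4 := by
      intro y
      have : DD k (insert l B) y = XX y k l + DD k B y := by
        unfold DD; rw [Finset.sum_insert hl]
      rw [this]; ring
    have hX : ∀ (y : V → C) a, XX (Function.update y l a) k l
        = (if a = y k then 1 else 0) - pp C := by
      intro y a; rw [XX_comm, XX_update_self hkl]
    have e1 : 𝔼 y : V → C, DD k B y ^ 3 * XX y k l = 0 := by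
      rw [expect_mul_avg (k := l) (fun y => DD k B y ^ 3) (fun y => XX y k l) (fun _ => 0)
        (fun y a => by simp only [DD_update' hl hkl]) (fun y => by simp_rw [hX]; exact q1 _)]
      simp
    have e2 : 𝔼 y : V → C, DD k B y ^ 2 * XX y k l ^ 2
        = pp C * (#B * (1 - pp C)) * (pp C * (1 - pp C)) := by
      rw [expect_mul_avg (k := l) (fun y => DD k B y ^ 2) (fun y => XX y k l ^ 2)
        (fun _ => pp C * (1 - pp C))
        (fun y a => by simp only [DD_update' hl hkl])
        (fun y => by simp_rw [hX, sq]; rw [q2]; simp), ← Finset.expect_mul, expect_DD_sq hk']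
    have e3 : 𝔼 y : V → C, DD k B y * XX y k l ^ 3 = 0 := by
      rw [expect_mul_avg (k := l) (fun y => DD k B y) (fun y => XX y k l ^ 3)
        (fun _ => κ)
        (fun y a => by simp only [DD_update' hl hkl])
        (fun y => by simp_rw [hX]; exact hκ _), ← Finset.expect_mul, expect_DD hk', zero_mul]
    have e4 : 𝔼 y : V → C, XX y k l ^ 4 ≤ pp C := by
      rw [expect_update l]
      refine Finset.expect_le univ_nonempty fun y _ => ?_
      simp_rw [hX]; exact q4 _
    simp_rw [h]
    rw [Finset.expect_add_distrib, Finset.expect_add_distrib, Finset.expect_add_distrib,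
      Finset.expect_add_distrib, ← Finset.mul_expect, ← Finset.mul_expect, ← Finset.mul_expect,
      e1, e2, e3, Finset.card_insert_of_notMem hl]
    have ih := ih hk'
    push_cast
    have hb : (0:ℝ) ≤ #B := by positivity
    have h5 : pp C * (#B * (1 - pp C)) * (pp C * (1 - pp C)) ≤ #B * pp C ^ 2 := by
      have : (1 - pp C) ^ 2 ≤ 1 := by nlinarith
      nlinarith [mul_nonneg hb (sq_nonneg (pp C))]
    nlinarith [sq_nonneg (pp C)]

lemma exp_taylor (x : ℝ) :
    ‖Complex.exp (x * Complex.I) - (1 + x * Complex.I - (x:ℂ) ^ 2 / 2)‖ ≤ 4 * |x| ^ 3 := by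
  have hn : ‖(x:ℂ) * Complex.I‖ = |x| := by simp
  by_cases hx : |x| ≤ 1
  · have := Complex.exp_bound (x := x * Complex.I) (by rw [hn]; exact hx) (n := 3) (by norm_num)
    rw [hn] at this
    simp only [Finset.sum_range_succ, Finset.sum_range_zero] at this
    have e : (1 + x * Complex.I - (x:ℂ) ^ 2 / 2) = 0 + (x * Complex.I) ^ 0 / (Nat.factorial 0 : ℕ) +
        (x * Complex.I) ^ 1 / (Nat.factorial 1 : ℕ) + (x * Complex.I) ^ 2 / (Nat.factorial 2 : ℕ) := by
      simp [mul_pow, Nat.factorial]; ring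
    rw [e]
    refine this.trans ?_
    have h0 : 0 ≤ |x| ^ 3 := by positivity
    norm_num [Nat.factorial]
    nlinarith
  · push Not at hx
    have h1 : ‖Complex.exp (x * Complex.I)‖ = 1 := Complex.norm_exp_ofReal_mul_I x
    have h2 : ‖(1 + x * Complex.I - (x:ℂ) ^ 2 / 2)‖ ≤ 1 + |x| + |x| ^ 2 / 2 := by
      refine (norm_sub_le _ _).trans (add_le_add ((norm_add_le _ _).trans ?_) ?_)
      · simp
      · simp
    refine (norm_sub_le _ _).trans ?_
    rw [h1]
    have : |x| ^ 2 ≥ |x| := by nlinarith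
    have : |x| ^ 3 ≥ |x| ^ 2 := by nlinarith [sq_nonneg (|x|)]
    nlinarith

lemma exp_neg_taylor {u : ℝ} (hu : 0 ≤ u) : |Real.exp (-u) - (1 - u)| ≤ u ^ 2 := by
  rw [abs_le]
  constructor
  · have := Real.add_one_le_exp (-u)
    nlinarith [sq_nonneg u]
  · have h1 : Real.exp (-u) ≤ 1 / (1 + u) := by
      rw [Real.exp_neg, ← one_div]
      apply one_div_le_one_div_of_le (by linarith)
      linarith [Real.add_one_le_exp u]
    have h2 : 1 / (1 + u) ≤ 1 - u + u ^ 2 := by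
      rw [div_le_iff₀ (by linarith)]
      nlinarith [pow_nonneg hu 3]
    linarith

lemma step_raw {k : V} {B : Finset V} (hk : k ∉ B) (F : (V → C) → ℂ)
    (hF : ∀ y a, F (Function.update y k a) = F y) (hF1 : ∀ y, ‖F y‖ ≤ 1) (τ : ℝ) :
    ‖𝔼 y, F y * (Complex.exp ((τ * DD k B y : ℝ) * Complex.I) -
      (Real.exp (-(τ ^ 2 * (pp C * (#B * (1 - pp C))) / 2)) : ℝ))‖ ≤
    4 * |τ| ^ 3 * 𝔼 y : V → C, |DD k B y| ^ 3 +
      τ ^ 2 / 2 * pp C * 𝔼 y : V → C, |TT B y - #B * (1 - pp C)| + (τ ^ 2 * (#B * pp C) / 2) ^ 2 := by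
  have hp := pp_pos (C := C)
  have hp1 := pp_le_one (C := C)
  set u : ℝ := τ ^ 2 * (pp C * (#B * (1 - pp C))) / 2 with hu
  have hb : (0:ℝ) ≤ #B := by positivity
  have hu0 : 0 ≤ u := by
    have : 0 ≤ 1 - pp C := by linarith
    positivity
  have hdec : ∀ y, F y * (Complex.exp ((τ * DD k B y : ℝ) * Complex.I) - (Real.exp (-u) : ℝ)) =
      F y * (Complex.exp ((τ * DD k B y : ℝ) * Complex.I) -
        (1 + (τ * DD k B y : ℝ) * Complex.I - ((τ * DD k B y : ℝ) : ℂ) ^ 2 / 2))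
      + (F y * ((DD k B y : ℝ) : ℂ)) * (τ * Complex.I)
      + F y * ((u - τ ^ 2 / 2 * DD k B y ^ 2 : ℝ) : ℂ)
      + F y * ((1 - u - Real.exp (-u) : ℝ) : ℂ) := by
    intro y
    push_cast
    ring
  simp_rw [hdec]
  rw [Finset.expect_add_distrib, Finset.expect_add_distrib, Finset.expect_add_distrib,
    ← Finset.expect_mul]
  have e2 : 𝔼 y, F y * ((DD k B y : ℝ) : ℂ) = 0 := by
    rw [expect_mul_avg (k := k) F _ (fun _ => 0) hF]
    · simp
    · intro y
      rw [← Complex.ofReal_expect, avg_DD hk]; simp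
  have e3 : 𝔼 y, F y * ((u - τ ^ 2 / 2 * DD k B y ^ 2 : ℝ) : ℂ) =
      𝔼 y, F y * ((-(τ ^ 2 / 2 * pp C * (TT B y - #B * (1 - pp C))) : ℝ) : ℂ) := by
    rw [expect_mul_avg (k := k) F _ _ hF]
    intro y
    rw [← Complex.ofReal_expect]
    rw [Finset.expect_sub_distrib, Fintype.expect_const, ← Finset.mul_expect, avg_DD_sq hk]
    congr 1
    rw [hu]; ring
  rw [e2, e3, zero_mul, add_zero]
  refine (norm_add_le _ _).trans (add_le_add ((norm_add_le _ _).trans (add_le_add ?_ ?_)) ?_)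
  · refine (RCLike.norm_expect_le (K := ℂ)).trans ?_
    rw [Finset.mul_expect]
    refine Finset.expect_le_expect fun y _ => ?_
    rw [norm_mul]
    refine (mul_le_of_le_one_left (norm_nonneg _) (hF1 y)).trans ?_
    refine (exp_taylor _).trans (le_of_eq ?_)
    rw [abs_mul]; ring
  · refine (RCLike.norm_expect_le (K := ℂ)).trans ?_
    rw [Finset.mul_expect]
    refine Finset.expect_le_expect fun y _ => ?_
    rw [norm_mul]
    refine (mul_le_of_le_one_left (norm_nonneg _) (hF1 y)).trans ?_
    rw [Complex.norm_real, Real.norm_eq_abs, abs_neg, abs_mul]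
    rw [abs_of_nonneg (show 0 ≤ τ ^ 2 / 2 * pp C by positivity)]
  · refine (RCLike.norm_expect_le (K := ℂ)).trans (Finset.expect_le univ_nonempty fun y _ => ?_)
    rw [norm_mul]
    refine (mul_le_of_le_one_left (norm_nonneg _) (hF1 y)).trans ?_
    rw [Complex.norm_real, Real.norm_eq_abs, abs_sub_comm]
    refine (exp_neg_taylor hu0).trans ?_
    have : u ≤ τ ^ 2 * (#B * pp C) / 2 := by
      rw [hu]
      have : pp C * (#B * (1 - pp C)) ≤ #B * pp C := by nlinarith [mul_nonneg hb (sq_nonneg (pp C))]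
      have := mul_le_mul_of_nonneg_left this (sq_nonneg τ)
      linarith
    gcongr

lemma expect_abs_cube {k : V} {B : Finset V} (hk : k ∉ B) {α : ℝ} (hα : 0 < α) :
    𝔼 y : V → C, |DD k B y| ^ 3 ≤ (α * (#B * pp C) + (#B * pp C + 3 * #B ^ 2 * pp C ^ 2) / α) / 2 := by
  have hp := pp_pos (C := C)
  have hp1 := pp_le_one (C := C)
  have h : ∀ x : ℝ, |x| ^ 3 ≤ α / 2 * x ^ 2 + 1 / (2 * α) * x ^ 4 := by
    intro x
    have h1 : α / 2 * x ^ 2 + 1 / (2 * α) * x ^ 4 - |x| ^ 3 = x ^ 2 * (α - |x|) ^ 2 / (2 * α) := by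
      have h2 : x ^ 4 = |x| ^ 4 := by rw [← abs_pow, abs_of_nonneg (by positivity)]
      have h3 : x ^ 2 = |x| ^ 2 := by rw [sq_abs]
      rw [h2, h3]
      field_simp
      ring
    have : 0 ≤ x ^ 2 * (α - |x|) ^ 2 / (2 * α) := by positivity
    linarith
  calc 𝔼 y : V → C, |DD k B y| ^ 3
      ≤ 𝔼 y : V → C, (α / 2 * DD k B y ^ 2 + 1 / (2 * α) * DD k B y ^ 4) :=
        Finset.expect_le_expect fun y _ => h _
    _ = α / 2 * (pp C * (#B * (1 - pp C))) + 1 / (2 * α) * 𝔼 y : V → C, DD k B y ^ 4 := by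
        rw [Finset.expect_add_distrib, ← Finset.mul_expect, ← Finset.mul_expect, expect_DD_sq hk]
    _ ≤ α / 2 * (#B * pp C) + 1 / (2 * α) * (#B * pp C + 3 * #B ^ 2 * pp C ^ 2) := by
        have hb : (0:ℝ) ≤ #B := by positivity
        have h4 := expect_DD_four (C := C) hk
        have : pp C * (#B * (1 - pp C)) ≤ #B * pp C := by nlinarith [mul_nonneg hb (sq_nonneg (pp C))]
        gcongr
    _ = _ := by field_simp

lemma expect_abs_TT (B : Finset V) :
    𝔼 y : V → C, |TT B y - #B * (1 - pp C)| ≤ #B * √(2 * pp C) := by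
  have hp := pp_pos (C := C)
  have h := Finset.expect_mul_sq_le_sq_mul_sq (univ : Finset (V → C))
    (fun y => |TT B y - #B * (1 - pp C)|) (fun _ => 1)
  simp only [mul_one, sq_abs, one_pow, Fintype.expect_const] at h
  have h2 := h.trans (expect_TT_var B)
  refine abs_le_of_sq_le_sq' ?_ (by positivity) |>.2
  rw [mul_pow, Real.sq_sqrt (by positivity)]
  linarith

noncomputable def KK (t : ℝ) : ℝ := 6 * |t| ^ 3 + t ^ 2 + t ^ 4

lemma step_num {k : V} {B : Finset V} (hk : k ∉ B) (F : (V → C) → ℂ)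
    (hF : ∀ y a, F (Function.update y k a) = F y) (hF1 : ∀ y, ‖F y‖ ≤ 1) (t s e η : ℝ)
    (he : 0 < e) (hs : 0 < s) (hse : s ^ 2 = e * pp C) (hη : 0 < η) (hη1 : η ≤ 1)
    (h1 : 1 / (e * pp C) ≤ η ^ 2) (h2 : 18 / e ≤ η ^ 4) (h3 : 2 * pp C ≤ η ^ 2)
    (hB : (#B : ℝ) ^ 2 ≤ 2 * e) :
    ‖𝔼 y, F y * (Complex.exp ((t / s * DD k B y : ℝ) * Complex.I) -
      (Real.exp (-(t ^ 2 / 2 * (1 - pp C) * (#B / e))) : ℝ))‖ ≤ KK t * η * (#B / e) := by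
  have hp := pp_pos (C := C)
  have hp1 := pp_le_one (C := C)
  have hb : (0:ℝ) ≤ #B := by positivity
  have h := step_raw hk F hF hF1 (t / s)
  have eu : (t / s) ^ 2 * (pp C * (#B * (1 - pp C))) / 2 = t ^ 2 / 2 * (1 - pp C) * (#B / e) := by
    rw [div_pow, hse]; field_simp
  rw [eu] at h
  refine h.trans ?_
  have hbe : 3 * (#B / e) ≤ η ^ 2 := by
    refine abs_le_of_sq_le_sq' ?_ (by positivity) |>.2
    calc (3 * (#B / e)) ^ 2 = 9 * (#B ^ 2) / e ^ 2 := by ring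
      _ ≤ 9 * (2 * e) / e ^ 2 := by gcongr
      _ = 18 / e := by field_simp; norm_num
      _ ≤ η ^ 4 := h2
      _ = _ := by ring
  have A : 4 * |t / s| ^ 3 * 𝔼 y : V → C, |DD k B y| ^ 3 ≤ 6 * |t| ^ 3 * η * (#B / e) := by
    have := expect_abs_cube (C := C) hk (α := s * η) (by positivity)
    calc 4 * |t / s| ^ 3 * 𝔼 y : V → C, |DD k B y| ^ 3 ≤ 4 * |t / s| ^ 3 *
        ((s * η * (#B * pp C) + (#B * pp C + 3 * #B ^ 2 * pp C ^ 2) / (s * η)) / 2) := by gcongr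
      _ = 2 * |t| ^ 3 * (η * (#B * pp C) / s ^ 2 +
          (#B * pp C + 3 * #B ^ 2 * pp C ^ 2) / ((s ^ 2) ^ 2 * η)) := by
        rw [abs_div, abs_of_pos hs, div_pow]; field_simp; ring
      _ = 2 * |t| ^ 3 * (#B / e) * (η + (1 / (e * pp C) + 3 * (#B / e)) / η) := by
        rw [hse]; field_simp
      _ ≤ 2 * |t| ^ 3 * (#B / e) * (η + (η ^ 2 + η ^ 2) / η) := by gcongr
      _ = _ := by field_simp; ring
  have B' : (t / s) ^ 2 / 2 * pp C * 𝔼 y : V → C, |TT B y - #B * (1 - pp C)| ≤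
      t ^ 2 * η * (#B / e) := by
    have hT := expect_abs_TT (C := C) B
    have hsq : √(2 * pp C) ≤ η := Real.sqrt_le_iff.2 ⟨hη.le, h3⟩
    calc (t / s) ^ 2 / 2 * pp C * 𝔼 y : V → C, |TT B y - #B * (1 - pp C)| ≤
        (t / s) ^ 2 / 2 * pp C * (#B * η) := by gcongr; exact hT.trans (by gcongr)
      _ = t ^ 2 * η * (#B / e) / 2 := by rw [div_pow, hse]; field_simp
      _ ≤ _ := half_le_self (by positivity)
  have C' : ((t / s) ^ 2 * (#B * pp C) / 2) ^ 2 ≤ t ^ 4 * η * (#B / e) := by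
    have hbe' : #B / e ≤ η := by
      have : 0 ≤ #B / e := by positivity
      nlinarith
    calc ((t / s) ^ 2 * (#B * pp C) / 2) ^ 2 = t ^ 4 / 4 * (#B / e) * (#B / e) := by
          rw [div_pow t s 2, hse]; field_simp; norm_num
      _ ≤ t ^ 4 / 4 * η * (#B / e) := by gcongr
      _ ≤ _ := by
        have : 0 ≤ t ^ 4 * η * (#B / e) := by positivity
        nlinarith
  unfold KK
  linarith

noncomputable def hsum (w : V → V → ℝ) (s : Finset V) : ℝ := (∑ i ∈ s, ∑ j ∈ s, w i j) / 2

lemma hsum_insert (w : V → V → ℝ) (hw : ∀ i j, w i j = w j i) (hw0 : ∀ i, w i i = 0)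
    {k : V} {s : Finset V} (hk : k ∉ s) :
    hsum w (insert k s) = hsum w s + ∑ j ∈ s, w k j := by
  unfold hsum
  rw [Finset.sum_insert hk]
  simp_rw [Finset.sum_insert hk]
  rw [Finset.sum_add_distrib, hw0]
  have : ∑ x ∈ s, w x k = ∑ x ∈ s, w k x := Finset.sum_congr rfl fun j _ => hw _ _
  rw [this]; ring

open Classical in
noncomputable def ew (G : SimpleGraph V) (i j : V) : ℝ := if G.Adj i j then 1 else 0

open Classical in
noncomputable def xw (G : SimpleGraph V) (y : V → C) (i j : V) : ℝ :=
  if G.Adj i j then XX y i j else 0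

open Classical in
lemma exists_low (G : SimpleGraph V) (s : Finset V) (hs : s.Nonempty) :
    ∃ k ∈ s, ((#((s.erase k).filter (G.Adj k)) : ℕ) : ℝ) ^ 2 ≤ 2 * hsum (ew G) s := by
  obtain ⟨k, hk, hmin⟩ := Finset.exists_min_image s (fun k => #(s.filter (G.Adj k))) hs
  refine ⟨k, hk, ?_⟩
  have h1 : #((s.erase k).filter (G.Adj k)) ≤ #(s.filter (G.Adj k)) :=
    Finset.card_le_card (Finset.filter_subset_filter _ (Finset.erase_subset _ _))
  have h2 : #(s.filter (G.Adj k)) ≤ #s := Finset.card_le_card (Finset.filter_subset _ _)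
  have h3 : 2 * hsum (ew G) s = ((∑ i ∈ s, #(s.filter (G.Adj i)) : ℕ) : ℝ) := by
    unfold hsum ew
    push_cast
    rw [mul_div_cancel₀ _ (two_ne_zero)]
    refine Finset.sum_congr rfl fun i _ => ?_
    rw [Finset.sum_boole]
  rw [h3]
  have h4 : #s * #(s.filter (G.Adj k)) ≤ ∑ i ∈ s, #(s.filter (G.Adj i)) := by
    rw [← smul_eq_mul]
    exact Finset.card_nsmul_le_sum _ _ _ hmin
  have : #((s.erase k).filter (G.Adj k)) ^ 2 ≤ ∑ i ∈ s, #(s.filter (G.Adj i)) := by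
    refine le_trans ?_ h4
    rw [sq]
    exact Nat.mul_le_mul (h1.trans h2) h1
  exact_mod_cast this

lemma hsum_xw_update (G : SimpleGraph V) {k : V} {s : Finset V} (hk : k ∉ s) (y : V → C) (a : C) :
    hsum (xw G (Function.update y k a)) s = hsum (xw G y) s := by
  unfold hsum
  congr 1
  refine Finset.sum_congr rfl fun i hi => Finset.sum_congr rfl fun j hj => ?_
  unfold xw
  rw [XX_update (by rintro rfl; exact hk hi) (by rintro rfl; exact hk hj) y a]

lemma main_ind (G : SimpleGraph V) (t σ e η : ℝ)
    (he : 0 < e) (hσ : 0 < σ) (hse : σ ^ 2 = e * pp C) (hη : 0 < η) (hη1 : η ≤ 1)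
    (h1 : 1 / (e * pp C) ≤ η ^ 2) (h2 : 18 / e ≤ η ^ 4) (h3 : 2 * pp C ≤ η ^ 2) :
    ∀ (m : ℕ) (s : Finset V), #s = m → hsum (ew G) s ≤ e →
    ‖𝔼 y : V → C, Complex.exp ((t / σ * hsum (xw G y) s : ℝ) * Complex.I) -
      (Real.exp (-(t ^ 2 / 2 * (1 - pp C) * (hsum (ew G) s / e))) : ℝ)‖
        ≤ KK t * η * (hsum (ew G) s / e) := by
  classical
  have hp1 := pp_le_one (C := C)
  intro m
  induction m with
  | zero =>
    intro s hs _
    rw [Finset.card_eq_zero] at hs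
    subst hs
    simp [hsum]
  | succ m ih =>
    intro s hs hle
    have hne : s.Nonempty := by rw [← Finset.card_pos]; omega
    obtain ⟨k, hk, hlow⟩ := exists_low G s hne
    set s' := s.erase k with hs'
    have hks : k ∉ s' := Finset.notMem_erase _ _
    have hins : s = insert k s' := (Finset.insert_erase hk).symm
    set B := s'.filter (G.Adj k) with hBdef
    have hkB : k ∉ B := fun h => hks (Finset.mem_of_mem_filter _ h)
    have hes : hsum (ew G) s = hsum (ew G) s' + #B := by
      rw [hins, hsum_insert _ (fun i j => by simp [ew, G.adj_comm]) (fun i => by simp [ew]) hks]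
      unfold ew
      rw [Finset.sum_boole]
    have hxs : ∀ y : V → C, hsum (xw G y) s = hsum (xw G y) s' + DD k B y := by
      intro y
      rw [hins, hsum_insert _ (fun i j => by unfold xw; rw [G.adj_comm, XX_comm])
        (fun i => by simp [xw]) hks]
      congr 1
      unfold xw DD
      rw [hBdef, Finset.sum_filter]
    have hb : (0:ℝ) ≤ #B := Nat.cast_nonneg _
    have ih' := ih s' (by rw [hs', Finset.card_erase_of_mem hk]; omega) (by linarith)
    have hst := step_num hkB (fun y : V → C => Complex.exp ((t / σ * hsum (xw G y) s' : ℝ) * Complex.I))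
      (fun y a => by simp only [hsum_xw_update G hks]) (fun y => by rw [Complex.norm_exp_ofReal_mul_I])
      t σ e η he hσ hse hη hη1 h1 h2 h3 (by linarith)
    set Φ : (V → C) → ℂ := fun y => Complex.exp ((t / σ * hsum (xw G y) s' : ℝ) * Complex.I) with hΦ
    set r : ℝ := Real.exp (-(t ^ 2 / 2 * (1 - pp C) * (#B / e))) with hr
    set q : ℝ := Real.exp (-(t ^ 2 / 2 * (1 - pp C) * (hsum (ew G) s' / e))) with hq
    have hr1 : r ≤ 1 := by
      rw [hr, Real.exp_le_one_iff]
      have : 0 ≤ 1 - pp C := by linarith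
      have : 0 ≤ t ^ 2 / 2 * (1 - pp C) * (#B / e) := mul_nonneg (by positivity) (div_nonneg hb he.le)
      linarith
    have hr0 : 0 ≤ r := (Real.exp_pos _).le
    have key : 𝔼 y : V → C, Complex.exp ((t / σ * hsum (xw G y) s : ℝ) * Complex.I) -
      (Real.exp (-(t ^ 2 / 2 * (1 - pp C) * (hsum (ew G) s / e))) : ℝ) =
        𝔼 y, Φ y * (Complex.exp ((t / σ * DD k B y : ℝ) * Complex.I) - r) +
          (r : ℂ) * (𝔼 y, Φ y - q) := by
      have c1 : Real.exp (-(t ^ 2 / 2 * (1 - pp C) * (hsum (ew G) s / e))) = r * q := by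
        rw [hr, hq, ← Real.exp_add, hes]; congr 1; ring
      have c2 : ∀ y, Complex.exp ((t / σ * hsum (xw G y) s : ℝ) * Complex.I) =
          Φ y * Complex.exp ((t / σ * DD k B y : ℝ) * Complex.I) := by
        intro y
        rw [hΦ, ← Complex.exp_add, hxs]
        congr 1; push_cast; ring
      rw [c1]
      simp_rw [c2, mul_sub]
      rw [ Finset.expect_sub_distrib, ← Finset.expect_mul]
      push_cast; ring
    rw [key]
    refine (norm_add_le _ _).trans ?_
    rw [norm_mul, Complex.norm_real, Real.norm_eq_abs, abs_of_nonneg hr0]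
    have h5 := mul_le_of_le_one_left (norm_nonneg (𝔼 y, Φ y - (q:ℂ))) hr1
    calc _ ≤ KK t * η * (#B / e) + KK t * η * (hsum (ew G) s' / e) :=
          add_le_add hst (h5.trans ih')
      _ = _ := by rw [hes]; ring

end Aux

section Fin
open Finset BigOperators

lemma hsum_ew_univ {V : Type*} [Fintype V] [DecidableEq V] (G : SimpleGraph V) :
    hsum (ew G) Finset.univ = (eCount G : ℝ) := by
  classical
  have h := G.sum_degrees_eq_twice_card_edges
  have h1 : eCount G = #G.edgeFinset := by
    unfold eCount
    rw [Nat.card_eq_fintype_card, SimpleGraph.edgeFinset_card]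
  have h2 : ∀ i, ∑ j, ew G i j = (G.degree i : ℝ) := by
    intro i
    unfold ew
    rw [Finset.sum_boole, ← SimpleGraph.card_neighborFinset_eq_degree]
    congr 2
    ext j; simp
  unfold hsum
  simp_rw [h2]
  rw [h1, ← Nat.cast_sum, h]
  push_cast; ring

lemma hsum_xw_univ {n c : ℕ} (G : SimpleGraph (Fin n)) (y : Fin n → Fin c) :
    hsum (xw G y) Finset.univ = (monoCount G y : ℝ) - (eCount G : ℝ) / (c : ℝ) := by
  classical
  let H : SimpleGraph (Fin n) :=
    { Adj := fun i j => G.Adj i j ∧ y i = y j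
      symm := ⟨fun i j h => ⟨h.1.symm, h.2.symm⟩⟩
      loopless := ⟨fun i h => G.loopless.irrefl i h.1⟩ }
  have hH : eCount H = monoCount G y := by
    unfold eCount monoCount
    refine Nat.card_congr (Equiv.subtypeEquivRight fun e => ?_)
    induction e using Sym2.ind with
    | _ i j => simp [H]
  have hx : ∀ i j, xw G y i j = ew H i j - ew G i j * (c:ℝ)⁻¹ := by
    intro i j
    unfold xw ew XX pp
    by_cases h : G.Adj i j <;> by_cases h' : y i = y j <;> simp [H, h, h']
  rw [← hH, ← hsum_ew_univ, ← hsum_ew_univ]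
  unfold hsum
  simp_rw [hx, Finset.sum_sub_distrib, ← Finset.sum_mul]
  ring

lemma uniform_clt (t ε : ℝ) (hε : 0 < ε) : ∃ M : ℝ, ∀ (n c : ℕ) (G : SimpleGraph (Fin n)),
    2 ≤ c → M ≤ c → M < (eCount G : ℝ) / (c : ℝ) →
    ‖𝔼 y : Fin n → Fin c, Complex.exp ((t * (((monoCount G y : ℝ) - (eCount G : ℝ) / (c : ℝ)) /
            Real.sqrt ((eCount G : ℝ) / (c : ℝ))) : ℝ) * Complex.I) -
      (Real.exp (-(t ^ 2 / 2)) : ℝ)‖ ≤ ε := by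
  have hK : 0 ≤ KK t := by unfold KK; positivity
  set η : ℝ := min 1 (ε / (KK t + t ^ 2 + 1)) with hη
  have hη0 : 0 < η := by rw [hη]; positivity
  have hη1 : η ≤ 1 := min_le_left _ _
  have hη2 : (KK t + t ^ 2) * η ≤ ε := by
    have : η ≤ ε / (KK t + t ^ 2 + 1) := min_le_right _ _
    rw [le_div_iff₀ (by positivity)] at this
    nlinarith
  have hη4 : η ^ 4 ≤ η ^ 2 := pow_le_pow_of_le_one hη0.le hη1 (by norm_num)
  refine ⟨18 / η ^ 4, fun n c G hc hMc hMe => ?_⟩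
  have : Nonempty (Fin c) := ⟨⟨0, by omega⟩⟩
  have hc0 : (0:ℝ) < c := by exact_mod_cast (by omega : 0 < c)
  have hc1 : (1:ℝ) ≤ c := by exact_mod_cast (by omega : 1 ≤ c)
  have hM0 : 0 < 18 / η ^ 4 := by positivity
  have hpp : pp (Fin c) = (c:ℝ)⁻¹ := by simp [pp]
  set e : ℝ := (eCount G : ℝ) with he
  have hec : 0 < e / c := hM0.trans hMe
  have he0 : 0 < e := by
    rcases div_pos_iff.1 hec with h | h
    · exact h.1
    · linarith
  have hee : e / c ≤ e := div_le_self he0.le hc1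
  have b1 : 18 / η ^ 4 < e := hMe.trans_le hee
  have c1 : 1 / (e / c) ≤ η ^ 2 := by
    rw [div_lt_iff₀ (by positivity)] at hMe
    rw [div_le_iff₀ hec]
    nlinarith
  have c2 : 18 / e ≤ η ^ 4 := by
    rw [div_lt_iff₀ (by positivity)] at b1
    rw [div_le_iff₀ he0]
    linarith
  have c3 : 2 * (c:ℝ)⁻¹ ≤ η ^ 2 := by
    rw [div_le_iff₀ (by positivity)] at hMc
    rw [← div_eq_mul_inv, div_le_iff₀ hc0]
    nlinarith
  have hm := main_ind (C := Fin c) G t (√(e / c)) e η he0 (Real.sqrt_pos.2 hec)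
    (by rw [Real.sq_sqrt hec.le, hpp, div_eq_mul_inv]) hη0 hη1
    (by rw [hpp, ← div_eq_mul_inv]; exact c1) c2 (by rw [hpp]; exact c3) _ Finset.univ rfl
    (by rw [hsum_ew_univ])
  rw [hsum_ew_univ, ← he, div_self he0.ne', mul_one, mul_one] at hm
  have hE : ∀ y : Fin n → Fin c, (t * (((monoCount G y : ℝ) - e / (c : ℝ)) / √(e / c)))
      = t / √(e / c) * hsum (xw G y) Finset.univ := by
    intro y
    rw [hsum_xw_univ]; ring
  simp_rw [hE]
  have hp : pp (Fin c) ≤ η := by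
    rw [hpp]; nlinarith [inv_pos.2 hc0]
  have hp0 := pp_pos (C := Fin c)
  have hd : ‖((Real.exp (-(t ^ 2 / 2 * (1 - pp (Fin c)))) : ℝ) : ℂ) - (Real.exp (-(t ^ 2 / 2)) : ℝ)‖
      ≤ t ^ 2 * η := by
    rw [← Complex.ofReal_sub, Complex.norm_real, Real.norm_eq_abs]
    set a := t ^ 2 / 2 * (1 - pp (Fin c)) with ha
    have ha0 : 0 ≤ a := mul_nonneg (by positivity) (by linarith [pp_le_one (C := Fin c)])
    set d := t ^ 2 / 2 * pp (Fin c) with hd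
    have hd0 : 0 ≤ d := by positivity
    have : -(t ^ 2 / 2) = -a + -d := by rw [ha, hd]; ring
    rw [this, Real.exp_add]
    have e1 : Real.exp (-a) ≤ 1 := Real.exp_le_one_iff.2 (by linarith)
    have e2 : Real.exp (-d) ≤ 1 := Real.exp_le_one_iff.2 (by linarith)
    have e3 := Real.add_one_le_exp (-d)
    have e4 := Real.exp_pos (-a)
    rw [abs_of_nonneg (by nlinarith)]
    have : d ≤ t ^ 2 * η := by rw [hd]; nlinarith [sq_nonneg t]
    nlinarith
  calc _ ≤ _ := norm_sub_le_norm_sub_add_norm_sub _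
          ((Real.exp (-(t ^ 2 / 2 * (1 - pp (Fin c)))) : ℝ) : ℂ) _
    _ ≤ KK t * η + t ^ 2 * η := add_le_add hm hd
    _ ≤ ε := by linarith

lemma uF (c : ℕ) (hc : 2 ≤ c) : IsProbabilityMeasure (uniformFin c) := by
  constructor
  unfold uniformFin
  simp only [Measure.smul_apply, smul_eq_mul, Measure.count_univ, ENat.card_eq_coe_fintype_card,
    Fintype.card_fin]
  exact ENNReal.inv_mul_cancel (by simp; omega) (by simp)

lemma integral_pi_unif (n c : ℕ) (hc : 2 ≤ c) (g : (Fin n → Fin c) → ℂ) :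
    ∫ y, g y ∂(Measure.pi fun _ : Fin n => uniformFin c) = 𝔼 y, g y := by
  have := uF c hc
  rw [integral_fintype (Integrable.of_finite)]
  rw [Fintype.expect_eq_sum_div_card, Finset.sum_div]
  refine Finset.sum_congr rfl fun y _ => ?_
  have : (Measure.pi fun _ : Fin n => uniformFin c).real {y} = ((c:ℝ) ^ n)⁻¹ := by
    rw [Measure.real, Measure.pi_singleton]
    simp [uniformFin]
  rw [this]
  simp [div_eq_inv_mul]

end Fin

theorem stmt2
    (Ω : ℕ → Type) [∀ n, MeasurableSpace (Ω n)]
    (P : ∀ n, Measure (Ω n)) [∀ n, IsProbabilityMeasure (P n)]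
    (c : ℕ → ℕ) (hc : ∀ n, 2 ≤ c n)
    (G : ∀ n, Ω n → SimpleGraph (Fin n))
    (Y : ∀ n, Ω n → (Fin n → Fin (c n)))
    (hmeas : ∀ n, Measurable (fun ω => (G n ω, Y n ω)))
    -- the graph is independent of the colors, and the colors are i.i.d. uniform:
    (hjoint : ∀ n, Measure.map (fun ω => (G n ω, Y n ω)) (P n)
      = (Measure.map (G n) (P n)).prod (Measure.pi fun _ : Fin n => uniformFin (c n)))
    -- c(n) → ∞:
    (hcinf : Tendsto c atTop atTop)
    -- |E(G_n)|/c(n) → ∞ in probability: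
    (hratio : ∀ M : ℝ,
      Tendsto (fun n => ((P n) {ω | (eCount (G n ω) : ℝ) / (c n : ℝ) ≤ M}).toReal) atTop (𝓝 0)) :
    -- (N(G_n) − |E(G_n)|/c)/√(|E(G_n)|/c) converges in distribution to N(0,1):
    ∀ f : ℝ →ᵇ ℝ,
      Tendsto (fun n => ∫ ω,
          f (((monoCount (G n ω) (Y n ω) : ℝ) - (eCount (G n ω) : ℝ) / (c n : ℝ)) /
            Real.sqrt ((eCount (G n ω) : ℝ) / (c n : ℝ))) ∂(P n)) atTop
        (𝓝 (∫ x, f x ∂(gaussianReal 0 1))) := by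
  have hdisc : ∀ n, DiscreteMeasurableSpace (SimpleGraph (Fin n)) := fun n => ⟨fun _ => trivial⟩
  let w : ∀ n, SimpleGraph (Fin n) × (Fin n → Fin (c n)) → ℝ := fun n z =>
    ((monoCount z.1 z.2 : ℝ) - (eCount z.1 : ℝ) / (c n : ℝ)) /
            Real.sqrt ((eCount z.1 : ℝ) / (c n : ℝ))
  have hwm : ∀ n, Measurable (w n) := fun n => measurable_of_countable _
  let W : ∀ n, Ω n → ℝ := fun n ω => w n (G n ω, Y n ω)
  have hW : ∀ n, Measurable (W n) := fun n => (hwm n).comp (hmeas n)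
  have hG : ∀ n, Measurable (G n) := fun n => measurable_fst.comp (hmeas n)
  let μ : ℕ → ProbabilityMeasure ℝ := fun n =>
    ⟨(P n).map (W n), Measure.isProbabilityMeasure_map (hW n).aemeasurable⟩
  let μ₀ : ProbabilityMeasure ℝ := ⟨gaussianReal 0 1, inferInstance⟩
  have key : Tendsto μ atTop (𝓝 μ₀) := by
    refine ProbabilityMeasure.tendsto_of_tendsto_charFun fun t => ?_
    have h0 : charFun (μ₀ : Measure ℝ) t = (Real.exp (-(t ^ 2 / 2)) : ℝ) := by
      change charFun (gaussianReal 0 1) t = _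
      rw [charFun_gaussianReal]
      push_cast
      congr 1
      simp
    rw [h0, Metric.tendsto_atTop']
    intro ε hε
    obtain ⟨M, hM⟩ := uniform_clt t (ε / 2) (by positivity)
    have hev1 : ∀ᶠ n in atTop, M ≤ (c n : ℝ) :=
      (tendsto_natCast_atTop_atTop.comp hcinf).eventually_ge_atTop M
    have hev2 : ∀ᶠ n in atTop, ((P n) {ω | (eCount (G n ω) : ℝ) / (c n : ℝ) ≤ M}).toReal < ε / 4 :=
      (hratio M).eventually_lt_const (by positivity)
    obtain ⟨N, hN⟩ := (hev1.and hev2).exists_forall_of_atTop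
    refine ⟨N, fun n hn => ?_⟩
    obtain ⟨hn1, hn2⟩ := hN n hn.le
    let g : SimpleGraph (Fin n) × (Fin n → Fin (c n)) → ℂ :=
      fun z => Complex.exp ((t * w n z : ℝ) * Complex.I)
    let φ : SimpleGraph (Fin n) → ℂ := fun H => Finset.expect Finset.univ (fun y => g (H, y))
    have hpr := uF (c n) (hc n)
    have hprG : IsProbabilityMeasure ((P n).map (G n)) :=
      Measure.isProbabilityMeasure_map (hG n).aemeasurable
    have hch : charFun (μ n : Measure ℝ) t = ∫ ω, φ (G n ω) ∂(P n) := by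
      change charFun ((P n).map (W n)) t = _
      rw [charFun_apply_real, integral_map (hW n).aemeasurable (by fun_prop)]
      have : ∀ ω, Complex.exp (t * (W n ω) * Complex.I) = g (G n ω, Y n ω) := by
        intro ω
        simp [g, W]
      simp_rw [this]
      rw [← integral_map (φ := fun ω => (G n ω, Y n ω)) (f := g) (hmeas n).aemeasurable
        (measurable_of_countable g).aestronglyMeasurable, hjoint, integral_prod _ .of_finite]
      simp_rw [integral_pi_unif n (c n) (hc n)]
      rw [integral_map (hG n).aemeasurable (measurable_of_countable _).aestronglyMeasurable]
    have hφ1 : ∀ H, ‖φ H‖ ≤ 1 := by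
      intro H
      have : Nonempty (Fin (c n)) := ⟨⟨0, by have := hc n; omega⟩⟩
      refine (RCLike.norm_expect_le (K := ℂ)).trans
        (Finset.expect_le Finset.univ_nonempty fun y _ => ?_)
      rw [Complex.norm_exp_ofReal_mul_I]
    set r : ℝ := Real.exp (-(t ^ 2 / 2)) with hr
    have hr1 : r ≤ 1 := Real.exp_le_one_iff.2 (by nlinarith [sq_nonneg t])
    have hr0 : 0 ≤ r := (Real.exp_pos _).le
    set S : Set (Ω n) := {ω | (eCount (G n ω) : ℝ) / (c n : ℝ) ≤ M} with hS
    have hSm : MeasurableSet S :=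
      hG n (t := {H | (eCount H : ℝ) / (c n : ℝ) ≤ M}) trivial
    have hφm : Measurable fun ω => φ (G n ω) := (measurable_of_countable φ).comp (hG n)
    have hφi : Integrable (fun ω => φ (G n ω)) (P n) :=
      Integrable.of_bound hφm.aestronglyMeasurable 1 (ae_of_all _ fun ω => hφ1 _)
    rw [dist_eq_norm, hch]
    have hsub : ∫ ω, φ (G n ω) ∂(P n) - (r:ℂ) = ∫ ω, (φ (G n ω) - r) ∂(P n) := by
      rw [integral_sub hφi (integrable_const _)]
      simp
    rw [hsub]
    have hb : ∀ ω, ‖φ (G n ω) - r‖ ≤ ε / 2 + S.indicator (fun _ => 2) ω := by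
      intro ω
      by_cases h : ω ∈ S
      · rw [Set.indicator_of_mem h]
        have : ‖φ (G n ω) - r‖ ≤ 1 + 1 := by
          refine (norm_sub_le _ _).trans (add_le_add (hφ1 _) ?_)
          rw [Complex.norm_real, Real.norm_eq_abs, abs_of_nonneg hr0]; exact hr1
        linarith
      · rw [Set.indicator_of_notMem h, add_zero]
        have h' : M < (eCount (G n ω) : ℝ) / (c n : ℝ) := by
          simpa [hS] using h
        exact hM n (c n) (G n ω) (hc n) hn1 h'
    calc ‖∫ ω, (φ (G n ω) - r) ∂(P n)‖ ≤ ∫ ω, ‖φ (G n ω) - r‖ ∂(P n) :=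
          norm_integral_le_integral_norm _
      _ ≤ ∫ ω, (ε / 2 + S.indicator (fun _ => (2:ℝ)) ω) ∂(P n) := by
          refine integral_mono (hφi.sub (integrable_const _)).norm ?_ hb
          exact (integrable_const _).add ((integrable_const _).indicator hSm)
      _ = ε / 2 + 2 * ((P n) S).toReal := by
          rw [integral_add (integrable_const _) ((integrable_const _).indicator hSm),
            integral_indicator_const _ hSm]
          simp [Measure.real, mul_comm]
      _ < ε := by linarith
  intro f
  have h := (ProbabilityMeasure.tendsto_iff_forall_integral_tendsto.1 key) f
  refine h.congr fun n => ?_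
  change ∫ x, f x ∂((P n).map (W n)) = _
  rw [integral_map (hW n).aemeasurable (f.continuous.aestronglyMeasurable)]
end

section
/- Let H be a finite simple graph with no isolated vertex and with minimum degree d_min(H) ≥ 2. Then the fractional stable number satisfies γ(H) ≤ |E(H)|/2. Moreover, if there exists an optimal solution φ of the defining linear program and a vertex v ∈ V(H) with φ(v) ≠ 0 and degree d(v) ≥ 3, then γ(H) < |E(H)|/2. -/
open SimpleGraph

/-- The fractional stable number γ(H): the maximum of ∑_v φ(v) over φ : V(H) → [0,1]
with φ(x) + φ(y) ≤ 1 for every edge {x,y}. -/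
noncomputable def fracStable {V : Type*} [Fintype V] (H : SimpleGraph V) : ℝ :=
  sSup {x : ℝ | ∃ φ : V → ℝ, (∀ v, φ v ∈ Set.Icc (0 : ℝ) 1) ∧
    (∀ ⦃u v⦄, H.Adj u v → φ u + φ v ≤ 1) ∧ x = ∑ v, φ v}

lemma key_aux {V : Type} [Fintype V] (H : SimpleGraph V) (φ : V → ℝ)
    (h : ∀ ⦃u v⦄, H.Adj u v → φ u + φ v ≤ 1) :
    ∑ v, (Nat.card (H.neighborSet v) : ℝ) * φ v ≤ (eCount H : ℝ) := by
  classical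
  have hd : ∀ v, (Nat.card (H.neighborSet v) : ℝ) = ∑ u, if H.Adj v u then (1 : ℝ) else 0 := by
    intro v
    rw [Nat.card_eq_fintype_card, SimpleGraph.card_neighborSet_eq_degree,
      ← SimpleGraph.card_neighborFinset_eq_degree, SimpleGraph.neighborFinset_eq_filter]
    simp
  have he : ∑ v, (Nat.card (H.neighborSet v) : ℝ) = 2 * (eCount H : ℝ) := by
    have := H.sum_degrees_eq_twice_card_edges
    unfold eCount
    rw [Nat.card_eq_fintype_card, ← SimpleGraph.edgeFinset_card]
    simp only [Nat.card_eq_fintype_card, SimpleGraph.card_neighborSet_eq_degree]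
    exact_mod_cast this
  have h1 : ∑ v, (Nat.card (H.neighborSet v) : ℝ) * φ v
      = ∑ v, ∑ u, if H.Adj v u then φ v else 0 := by
    refine Finset.sum_congr rfl fun v _ => ?_
    rw [hd, Finset.sum_mul]
    refine Finset.sum_congr rfl fun u _ => ?_
    split_ifs <;> simp
  have h2 : ∑ v, (Nat.card (H.neighborSet v) : ℝ) * φ v
      = ∑ v, ∑ u, if H.Adj v u then φ u else 0 := by
    rw [h1, Finset.sum_comm]
    simp only [SimpleGraph.adj_comm]
  have h3 : (∑ v, ∑ u, if H.Adj v u then φ v else 0) + (∑ v, ∑ u, if H.Adj v u then φ u else 0)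
      ≤ ∑ v, (Nat.card (H.neighborSet v) : ℝ) := by
    rw [← Finset.sum_add_distrib]
    refine Finset.sum_le_sum fun v _ => ?_
    rw [hd, ← Finset.sum_add_distrib]
    refine Finset.sum_le_sum fun u _ => ?_
    split_ifs with hh
    · exact h hh
    · simp
  linarith

/-- If H has no isolated vertex and minimum degree ≥ 2 then γ(H) ≤ |E(H)|/2; moreover if some
optimal solution φ has a vertex v with φ(v) ≠ 0 and degree ≥ 3 then γ(H) < |E(H)|/2. -/
theorem stmt10 {V : Type} [Fintype V] (H : SimpleGraph V)
    (hiso : ∀ v : V, ∃ u, H.Adj v u)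
    (hmin : ∀ v : V, 2 ≤ Nat.card (H.neighborSet v)) :
    fracStable H ≤ (eCount H : ℝ) / 2 ∧
    (∀ φ : V → ℝ, (∀ v, φ v ∈ Set.Icc (0 : ℝ) 1) →
      (∀ ⦃u v⦄, H.Adj u v → φ u + φ v ≤ 1) →
      (∑ v, φ v) = fracStable H →
      (∃ v, φ v ≠ 0 ∧ 3 ≤ Nat.card (H.neighborSet v)) →
      fracStable H < (eCount H : ℝ) / 2) := by
  have hm : ∀ v, (2 : ℝ) ≤ (Nat.card (H.neighborSet v) : ℝ) := fun v => by exact_mod_cast hmin v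
  constructor
  · unfold fracStable
    apply csSup_le
    · exact ⟨_, fun _ => 0, by simp, by simp, rfl⟩
    · rintro x ⟨φ, h0, h1, rfl⟩
      have hk := key_aux H φ h1
      have : ∑ v, 2 * φ v ≤ ∑ v, (Nat.card (H.neighborSet v) : ℝ) * φ v :=
        Finset.sum_le_sum fun v _ => mul_le_mul_of_nonneg_right (hm v) (h0 v).1
      rw [← Finset.mul_sum] at this
      linarith
  · rintro φ h0 h1 hs ⟨v, hv, hv3⟩
    rw [← hs]
    have hk := key_aux H φ h1
    have hv3' : (3 : ℝ) ≤ (Nat.card (H.neighborSet v) : ℝ) := by exact_mod_cast hv3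
    have hpos : 0 < φ v := lt_of_le_of_ne (h0 v).1 (Ne.symm hv)
    have : ∑ v, 2 * φ v < ∑ v, (Nat.card (H.neighborSet v) : ℝ) * φ v :=
      Finset.sum_lt_sum (fun v _ => mul_le_mul_of_nonneg_right (hm v) (h0 v).1)
        ⟨v, Finset.mem_univ v, mul_lt_mul_of_pos_right (by linarith) hpos⟩
    rw [← Finset.mul_sum] at this
    linarith
end

section
/- Let H be a finite simple graph with no isolated vertex and γ(H) > |V(H)|/2, and let φ : V(H) → [0,1] be an optimal solution of the defining linear program taking values only in {0, 1/2, 1}. Partition V(H) = V_0 ∪ V_{1/2} ∪ V_1 where V_a = {v : φ(v) = a}. Then: (i) the bipartite graph with parts V_0 and V_1 whose edges are the edges of H between V_0 and V_1 has a matching saturating every vertex of V_0; (ii) the subgraph of H induced by V_{1/2} has a spanning subgraph which is a disjoint union of cycles and isolated edges. -/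
open SimpleGraph

open Classical in
theorem stmt11_arith (a b x y : ℝ) (P Q R S : Prop)
    (hab : (a = 0 ∧ b = 1) ∨ (a = 1 / 2 ∧ b = 1 / 2)) (hxy : x + y ≤ 1)
    (h1 : P → x = a) (h2 : Q → y = a) (h3 : P → y = b → S) (h4 : Q → x = b → R)
    (h5 : R → x = b) (h6 : S → y = b)
    (hx : x = 0 ∨ x = 1 / 2 ∨ x = 1) (hy : y = 0 ∨ y = 1 / 2 ∨ y = 1) :
    x + (if P then (1 / 2 : ℝ) else 0) - (if R then (1 / 2 : ℝ) else 0) +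
      (y + (if Q then (1 / 2 : ℝ) else 0) - (if S then (1 / 2 : ℝ) else 0)) ≤ 1 := by
  by_cases hP : P <;> by_cases hQ : Q <;> by_cases hR : R <;> by_cases hS : S <;>
    simp only [hP, hQ, hR, hS, if_true, if_false, true_imp_iff, false_imp_iff, imp_false] at * <;>
    rcases hab with ⟨rfl, rfl⟩ | ⟨rfl, rfl⟩ <;> first
    | linarith
    | (rcases hx with rfl | rfl | rfl <;> rcases hy with rfl | rfl | rfl <;>
        first
        | linarith
        | (exfalso; norm_num at *))

open Classical in
theorem stmt11_aux {V : Type} [Fintype V] (H : SimpleGraph V)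
    (φ : V → ℝ)
    (hfeas₁ : ∀ v, φ v ∈ Set.Icc (0 : ℝ) 1)
    (hfeas₂ : ∀ ⦃u v⦄, H.Adj u v → φ u + φ v ≤ 1)
    (hopt : (∑ v, φ v) = fracStable H)
    (hval : ∀ v, φ v = 0 ∨ φ v = 1 / 2 ∨ φ v = 1)
    (a b : ℝ) (hab : (a = 0 ∧ b = 1) ∨ (a = 1 / 2 ∧ b = 1 / 2)) :
    ∃ f : {v // φ v = a} → {v // φ v = b},
      Function.Injective f ∧ ∀ v, H.Adj v.1 (f v).1 := by
  refine (Fintype.all_card_le_filter_rel_iff_exists_injective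
    (fun (x : {v // φ v = a}) (y : {v // φ v = b}) => H.Adj x.1 y.1)).1 ?_
  intro A
  by_contra hlt
  push Not at hlt
  set B : Finset {v // φ v = b} := Finset.univ.filter (fun y => ∃ x ∈ A, H.Adj x.1 y.1) with hB
  set A' : Finset V := A.map (Function.Embedding.subtype _) with hA'
  set B' : Finset V := B.map (Function.Embedding.subtype _) with hB'
  have hcard : (B'.card : ℝ) < A'.card := by
    rw [hA', hB', Finset.card_map, Finset.card_map]; exact_mod_cast hlt
  have mA : ∀ v ∈ A', φ v = a := by
    intro v hv
    simp only [hA', Finset.mem_map, Function.Embedding.coe_subtype] at hv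
    obtain ⟨x, _, rfl⟩ := hv
    exact x.2
  have mB : ∀ v, v ∈ B' ↔ φ v = b ∧ ∃ u ∈ A', H.Adj u v := by
    intro v
    simp [hA', hB', hB]
    grind
  clear_value A' B'
  have key : (∑ v, (φ v + (if v ∈ A' then (1 / 2 : ℝ) else 0) - (if v ∈ B' then (1 / 2 : ℝ) else 0)))
      ≤ fracStable H := by
    apply le_csSup
    · refine ⟨∑ v : V, (1 : ℝ), ?_⟩
      rintro x ⟨ψ, h1, -, rfl⟩
      exact Finset.sum_le_sum fun v _ => (h1 v).2
    · refine ⟨_, ?_, ?_, rfl⟩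
      · intro v
        have h1 := mA v
        have h2 : v ∈ B' → φ v = b := fun h => ((mB v).1 h).1
        obtain ⟨h3, h4⟩ := hfeas₁ v
        clear mA mB hA' hB' hval hfeas₁ hfeas₂ hopt hcard hlt hB
        by_cases hA1 : v ∈ A' <;> by_cases hB1 : v ∈ B' <;>
        simp only [hA1, hB1, if_true, if_false, true_imp_iff] at * <;>
        rcases hab with ⟨rfl, rfl⟩ | ⟨rfl, rfl⟩ <;> constructor <;> linarith
      · intro u v huv
        have := hfeas₂ huv
        have h1 := mA v
        have h2 := mB v
        have h1' := mA u
        have h2' := mB u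
        have h3 : u ∈ A' → φ v = b → v ∈ B' := fun h h' => (mB v).2 ⟨h', u, h, huv⟩
        have h4 : v ∈ A' → φ u = b → u ∈ B' := fun h h' => (mB u).2 ⟨h', v, h, huv.symm⟩
        have h5 : u ∈ B' → φ u = b := fun h => ((mB u).1 h).1
        have h6 : v ∈ B' → φ v = b := fun h => ((mB v).1 h).1
        clear h2 h2' mA mB
        have hu := hval u
        have hv := hval v
        clear hval hfeas₁ hfeas₂ hopt
        convert stmt11_arith _ _ _ _ _ _ _ _ hab this h1' h1 h3 h4 h5 h6 hu hv
  rw [Finset.sum_sub_distrib, Finset.sum_add_distrib, hopt] at key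
  simp only [Finset.sum_ite_mem, Finset.univ_inter, Finset.sum_const, nsmul_eq_mul] at key
  linarith

/-- Structural lemma: if H has no isolated vertex, γ(H) > |V(H)|/2, and φ is an optimal
solution taking values in {0, 1/2, 1}, then (i) there is a matching (an injection along edges
of H) of V₀ = φ⁻¹(0) into V₁ = φ⁻¹(1), and (ii) the subgraph induced by V_{1/2} = φ⁻¹(1/2)
has a spanning subgraph that is a disjoint union of cycles and isolated edges (equivalently,
a fixed-point-free permutation moving each vertex to a neighbor). -/
theorem stmt11 {V : Type} [Fintype V] (H : SimpleGraph V)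
    (hiso : ∀ v : V, ∃ u, H.Adj v u)
    (hγ : (Fintype.card V : ℝ) / 2 < fracStable H)
    (φ : V → ℝ)
    (hfeas₁ : ∀ v, φ v ∈ Set.Icc (0 : ℝ) 1)
    (hfeas₂ : ∀ ⦃u v⦄, H.Adj u v → φ u + φ v ≤ 1)
    (hopt : (∑ v, φ v) = fracStable H)
    (hval : ∀ v, φ v = 0 ∨ φ v = 1 / 2 ∨ φ v = 1) :
    (∃ f : {v // φ v = 0} → {v // φ v = 1},
      Function.Injective f ∧ ∀ v, H.Adj v.1 (f v).1) ∧
    (∃ σ : Equiv.Perm {v // φ v = 1 / 2}, ∀ v, σ v ≠ v ∧ H.Adj v.1 (σ v).1) := by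
  refine ⟨stmt11_aux H φ hfeas₁ hfeas₂ hopt hval 0 1 (Or.inl ⟨rfl, rfl⟩), ?_⟩
  obtain ⟨f, hf, hadj⟩ := stmt11_aux H φ hfeas₁ hfeas₂ hopt hval (1 / 2) (1 / 2) (Or.inr ⟨rfl, rfl⟩)
  refine ⟨Equiv.ofBijective f (Finite.injective_iff_bijective.1 hf), fun v => ⟨fun h => ?_, hadj v⟩⟩
  have := hadj v
  rw [Equiv.ofBijective_apply] at h
  rw [h] at this
  exact H.loopless.irrefl _ this
end

section
/- Let (Ω_n, F_n, P_n) be a sequence of probability spaces, G_n ⊂ F_n sub-σ-fields, and (X_n, Y_n) random variables on (Ω_n, F_n) such that for every k ≥ 1 the conditional expectations U_{n,k} = E(X_n^k | G_n) and V_{n,k} = E(Y_n^k | G_n) exist as finite random variables. Suppose: (a) for every k ≥ 1 and every ε > 0, limsup_{n→∞} P_n(|U_{n,k} − V_{n,k}| > ε) = 0; and (b) there exists η > 0 such that for every ε > 0, limsup_{k→∞} limsup_{n→∞} P_n(|η^k/k! · U_{n,k}| > ε) = 0. Then for every real t, E e^{itX_n} − E e^{itY_n} → 0 as n → ∞. 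-/
open MeasureTheory Filter
open scoped ENNReal Topology

lemma aux_taylor (c : ℂ) (hc : ‖c‖ = 1) (hre : c.re = 0) (k : ℕ) : ∀ u : ℝ, 0 ≤ u →
    ‖Complex.exp (c * u) - ∑ l ∈ Finset.range k, (c * u) ^ l / (l.factorial : ℂ)‖
      ≤ u ^ k / (k.factorial : ℝ) := by
  induction k with
  | zero =>
    intro u hu
    simp [Complex.norm_exp, hre]
  | succ k ih =>
    intro u hu
    have hder : ∀ x : ℝ, HasDerivAt (fun u : ℝ => Complex.exp (c * u) -
        ∑ l ∈ Finset.range (k + 1), (c * u) ^ l / (l.factorial : ℂ))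
        (c * (Complex.exp (c * x) - ∑ l ∈ Finset.range k, (c * x) ^ l / (l.factorial : ℂ))) x := by
      intro x
      have h1 : HasDerivAt (fun u : ℝ => c * (u : ℂ)) c x := by
        simpa using (Complex.ofRealCLM.hasDerivAt (x := x)).const_mul c
      have h2 : ∀ l : ℕ, HasDerivAt (fun u : ℝ => (c * (u : ℂ)) ^ (l + 1) / ((l + 1).factorial : ℂ))
          (c * ((c * x) ^ l / (l.factorial : ℂ))) x := by
        intro l
        have := (h1.pow (l + 1)).div_const ((l + 1).factorial : ℂ)
        refine this.congr_deriv ?_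
        have h3 : (l.factorial : ℂ) ≠ 0 := by exact_mod_cast l.factorial_ne_zero
        have h4 : (l : ℂ) + 1 ≠ 0 := by exact_mod_cast l.succ_ne_zero
        simp only [Nat.factorial_succ, Nat.add_sub_cancel]
        push_cast
        field_simp
      have h5 := HasDerivAt.fun_sum (u := Finset.range k) (fun l _ => h2 l)
      have h6 := h1.cexp.sub (h5.add_const (1 : ℂ))
      refine (h6.congr_deriv ?_).congr_of_eventuallyEq ?_
      · rw [mul_sub, Finset.mul_sum]; ring
      · refine Eventually.of_forall fun y => ?_
        simp [Finset.sum_range_succ']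
    refine image_norm_le_of_norm_deriv_right_le_deriv_boundary (a := 0) (b := u)
      (f := fun u : ℝ => Complex.exp (c * u) -
        ∑ l ∈ Finset.range (k + 1), (c * u) ^ l / (l.factorial : ℂ))
      (B := fun u => u ^ (k + 1) / ((k + 1).factorial : ℝ)) (B' := fun u => u ^ k / (k.factorial : ℝ))
      (fun x _ => (hder x).continuousAt.continuousWithinAt)
      (fun x _ => (hder x).hasDerivWithinAt) ?_ ?_ ?_ ⟨hu, le_rfl⟩
    · simp [Finset.sum_range_succ']
    · intro x
      refine ((hasDerivAt_pow (k + 1) x).div_const _).congr_deriv ?_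
      have h3 : (k.factorial : ℝ) ≠ 0 := by exact_mod_cast k.factorial_ne_zero
      simp only [Nat.factorial_succ, Nat.add_sub_cancel]
      push_cast
      field_simp
    · intro x hx
      rw [norm_mul, hc, one_mul]
      exact ih x hx.1

lemma aux_taylor' (k : ℕ) (u : ℝ) :
    ‖Complex.exp ((u : ℂ) * Complex.I) -
      ∑ l ∈ Finset.range k, ((u : ℂ) * Complex.I) ^ l / (l.factorial : ℂ)‖
      ≤ |u| ^ k / (k.factorial : ℝ) := by
  rcases le_total 0 u with h | h
  · have := aux_taylor Complex.I (by simp) (by simp) k u h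
    rw [abs_of_nonneg h]
    simpa only [mul_comm] using this
  · have := aux_taylor (-Complex.I) (by simp) (by simp) k (-u) (by linarith)
    rw [abs_of_nonpos h]
    have e : -Complex.I * ((-u : ℝ) : ℂ) = (u : ℂ) * Complex.I := by push_cast; ring
    rwa [e] at this

noncomputable def auxF (j : ℕ) (s x : ℝ) : ℂ := (x : ℂ) ^ j * Complex.exp ((s * x : ℝ) * Complex.I)

noncomputable def auxC (s t : ℝ) (l : ℕ) : ℂ := (((t - s : ℝ) : ℂ) * Complex.I) ^ l / (l.factorial : ℂ)

lemma auxF_taylor (j k : ℕ) (s t x : ℝ) :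
    ‖auxF j t x - ∑ l ∈ Finset.range k, auxC s t l * auxF (j + l) s x‖ ≤
      |t - s| ^ k / (k.factorial : ℝ) * |x| ^ (j + k) := by
  have h := aux_taylor' k ((t - s) * x)
  have e : auxF j t x - ∑ l ∈ Finset.range k, auxC s t l * auxF (j + l) s x =
      auxF j s x * (Complex.exp ((((t - s) * x : ℝ) : ℂ) * Complex.I) -
      ∑ l ∈ Finset.range k, ((((t - s) * x : ℝ) : ℂ) * Complex.I) ^ l / (l.factorial : ℂ)) := by
    rw [mul_sub, Finset.mul_sum]
    congr 1
    · unfold auxF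
      rw [mul_assoc, ← Complex.exp_add]
      congr 2
      push_cast; ring
    · refine Finset.sum_congr rfl fun l _ => ?_
      unfold auxF auxC
      push_cast
      rw [mul_right_comm ((t : ℂ) - s) (x : ℂ) Complex.I, mul_pow _ (x : ℂ) l, pow_add]
      ring
  have hn : ‖auxF j s x‖ = |x| ^ j := by
    unfold auxF
    rw [norm_mul, Complex.norm_exp_ofReal_mul_I, norm_pow, mul_one, Complex.norm_real,
      Real.norm_eq_abs]
  rw [e, norm_mul, hn]
  calc |x| ^ j * _ ≤ |x| ^ j * (|(t - s) * x| ^ k / (k.factorial : ℝ)) := by gcongr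
    _ = _ := by rw [abs_mul]; ring

lemma auxF_norm (j : ℕ) (s x : ℝ) : ‖auxF j s x‖ = ‖x ^ j‖ := by
  unfold auxF
  rw [norm_mul, Complex.norm_exp_ofReal_mul_I, norm_pow, mul_one, Complex.norm_real, norm_pow]

lemma auxF_cont (j : ℕ) (s : ℝ) : Continuous (auxF j s) := by
  unfold auxF
  fun_prop

section single
variable {Ω : Type} {m0 : MeasurableSpace Ω} (μ : Measure Ω) [IsProbabilityMeasure μ]

lemma auxF_int (X : Ω → ℝ) (hX : ∀ k : ℕ, 1 ≤ k → Integrable (fun ω => X ω ^ k) μ) (j : ℕ) (s : ℝ) :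
    Integrable (fun ω => auxF j s (X ω)) μ := by
  have hm : AEStronglyMeasurable X μ := by simpa using (hX 1 le_rfl).aestronglyMeasurable
  have hj : Integrable (fun ω => X ω ^ j) μ := by
    rcases Nat.eq_zero_or_pos j with rfl | h
    · simp
    · exact hX j h
  exact hj.mono ((auxF_cont j s).comp_aestronglyMeasurable hm)
    (Eventually.of_forall fun ω => (auxF_norm j s (X ω)).le)

noncomputable def auxD (m : MeasurableSpace Ω) (X Y : Ω → ℝ) (j : ℕ) (s : ℝ) : Ω → ℂ :=
  μ[fun ω => auxF j s (X ω) - auxF j s (Y ω) | m]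

lemma auxD_step (m : MeasurableSpace Ω) (X Y : Ω → ℝ)
    (hX : ∀ k : ℕ, 1 ≤ k → Integrable (fun ω => X ω ^ k) μ)
    (hY : ∀ k : ℕ, 1 ≤ k → Integrable (fun ω => Y ω ^ k) μ)
    (j k : ℕ) (s t : ℝ) (hk : 1 ≤ j + k) (hev : Even (j + k)) :
    ∀ᵐ ω ∂μ, ‖auxD μ m X Y j t ω‖ ≤
      ‖∑ l ∈ Finset.range k, auxC s t l * auxD μ m X Y (j + l) s ω‖ +
      |t - s| ^ k / (k.factorial : ℝ) *
        ((μ[fun ω => X ω ^ (j + k) | m]) ω + (μ[fun ω => Y ω ^ (j + k) | m]) ω) := by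
  set a : ℝ := |t - s| ^ k / (k.factorial : ℝ) with ha
  have ha0 : 0 ≤ a := by positivity
  let g : ℕ → ℝ → Ω → ℂ := fun j s ω => auxF j s (X ω) - auxF j s (Y ω)
  have hg : ∀ j s, Integrable (g j s) μ := fun j s =>
    (auxF_int μ X hX j s).sub (auxF_int μ Y hY j s)
  let S : Ω → ℂ := ∑ l ∈ Finset.range k, auxC s t l • g (j + l) s
  have hSi : Integrable S μ := integrable_finsetSum' _ fun l _ => (hg _ _).smul _
  have h1 : μ[g j t - S | m] =ᵐ[μ] μ[g j t | m] - μ[S | m] := condExp_sub (hg _ _) hSi m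
  have h2 : μ[S | m] =ᵐ[μ] ∑ l ∈ Finset.range k, μ[auxC s t l • g (j + l) s | m] :=
    condExp_finsetSum (fun l _ => (hg _ _).smul _) m
  have h3 : ∀ᵐ ω ∂μ, ∀ l, (μ[auxC s t l • g (j + l) s | m]) ω =
      auxC s t l * (μ[g (j + l) s | m]) ω :=
    ae_all_iff.2 fun l => condExp_smul (auxC s t l) (g (j + l) s) m
  have h4 := norm_condExp_le (μ := μ) (m := m) (g j t - S)
  have hXk := hX _ hk
  have hYk := hY _ hk
  have h5 : μ[(fun ω => ‖(g j t - S) ω‖) | m] ≤ᵐ[μ]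
      μ[a • ((fun ω => X ω ^ (j + k)) + (fun ω => Y ω ^ (j + k))) | m] := by
    refine condExp_mono ((hg _ _).sub hSi).norm ((hXk.add hYk).smul a)
      (Eventually.of_forall fun ω => ?_)
    have e : (g j t - S) ω =
      (auxF j t (X ω) - ∑ l ∈ Finset.range k, auxC s t l * auxF (j + l) s (X ω)) -
      (auxF j t (Y ω) - ∑ l ∈ Finset.range k, auxC s t l * auxF (j + l) s (Y ω)) := by
      simp only [g, S, Pi.sub_apply, Finset.sum_apply, Pi.smul_apply, smul_eq_mul, mul_sub,
        Finset.sum_sub_distrib]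
      ring
    simp only [e, Pi.smul_apply, Pi.add_apply, smul_eq_mul]
    refine (norm_sub_le _ _).trans ?_
    have q1 := auxF_taylor j k s t (X ω)
    have q2 := auxF_taylor j k s t (Y ω)
    rw [hev.pow_abs, ← ha] at q1 q2
    linarith
  have h6 := condExp_smul (μ := μ) a ((fun ω => X ω ^ (j + k)) + (fun ω => Y ω ^ (j + k))) m
  have h7 := condExp_add hXk hYk m
  filter_upwards [h1, h2, h3, h4, h5, h6, h7] with ω h1 h2 h3 h4 h5 h6 h7
  have h8 : ‖(μ[g j t - S | m]) ω‖ ≤ a * ((μ[fun ω => X ω ^ (j + k) | m]) ω +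
      (μ[fun ω => Y ω ^ (j + k) | m]) ω) := by
    refine (h4.trans h5).trans ?_
    rw [h6, Pi.smul_apply, h7, Pi.add_apply, smul_eq_mul]
  rw [h1, Pi.sub_apply, h2, Finset.sum_apply, Finset.sum_congr rfl (fun l _ => h3 l)] at h8
  change ‖(μ[g j t | m]) ω‖ ≤ ‖∑ l ∈ Finset.range k, auxC s t l * (μ[g (j + l) s | m]) ω‖ + _
  have h9 := norm_sub_norm_le ((μ[g j t | m]) ω)
    (∑ l ∈ Finset.range k, auxC s t l * (μ[g (j + l) s | m]) ω)
  linarith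

lemma aux_meas {Ω : Type} {m0 : MeasurableSpace Ω} (f : Ω → ℂ) (hf : Measurable f) (ε : ℝ) :
    MeasurableSet {ω | ε < ‖f ω‖} := measurableSet_lt measurable_const hf.norm

lemma auxD_int (m : MeasurableSpace Ω) (hm : m ≤ m0) (X Y : Ω → ℝ)
    (hX : ∀ k : ℕ, 1 ≤ k → Integrable (fun ω => X ω ^ k) μ)
    (hY : ∀ k : ℕ, 1 ≤ k → Integrable (fun ω => Y ω ^ k) μ) (t ε : ℝ) (hε : 0 ≤ ε) :
    ‖(∫ ω, Complex.exp ((t * X ω : ℝ) * Complex.I) ∂μ) -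
      (∫ ω, Complex.exp ((t * Y ω : ℝ) * Complex.I) ∂μ)‖ ≤
      ε + 2 * μ.real {ω | ε < ‖auxD μ m X Y 0 t ω‖} := by
  have i1 := auxF_int μ X hX 0 t
  have i2 := auxF_int μ Y hY 0 t
  have e : (∫ ω, Complex.exp ((t * X ω : ℝ) * Complex.I) ∂μ) -
      (∫ ω, Complex.exp ((t * Y ω : ℝ) * Complex.I) ∂μ) = ∫ ω, auxD μ m X Y 0 t ω ∂μ := by
    unfold auxD
    rw [integral_condExp hm, integral_sub i1 i2]
    simp [auxF]
  have hb : ∀ᵐ ω ∂μ, ‖auxD μ m X Y 0 t ω‖ ≤ 2 := by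
    refine ae_bdd_norm_condExp_of_ae_bdd_norm (Eventually.of_forall fun ω => ?_)
    refine (norm_sub_le _ _).trans ?_
    rw [auxF_norm, auxF_norm]; norm_num
  have hsm : Measurable[m0] (auxD μ m X Y 0 t) :=
    (stronglyMeasurable_condExp.mono hm).measurable
  set A := {ω | ε < ‖auxD μ m X Y 0 t ω‖} with hA
  have hAm : MeasurableSet[m0] A := aux_meas _ hsm ε
  rw [e]
  have hint : Integrable (fun ω => ε + A.indicator (fun _ => (2 : ℝ)) ω) μ :=
    (integrable_const _).add ((integrable_const _).indicator hAm)
  refine (norm_integral_le_of_norm_le hint ?_).trans ?_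
  · filter_upwards [hb] with ω hω
    by_cases h : ω ∈ A
    · simp only [Set.indicator_of_mem h]; linarith
    · simp only [Set.indicator_of_notMem h]
      have : ¬ ε < ‖auxD μ m X Y 0 t ω‖ := h
      linarith
  · rw [integral_add (integrable_const _) ((integrable_const _).indicator hAm),
      integral_indicator_const _ hAm]
    simp [mul_comm]

end single

section seq
variable {Ω : ℕ → Type} {m : ∀ n, MeasurableSpace (Ω n)}
    (P : ∀ n, Measure (Ω n)) [∀ n, IsProbabilityMeasure (P n)]

def auxTP (Z : ∀ n, Ω n → ℂ) : Prop :=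
  ∀ ε : ℝ, 0 < ε → Tendsto (fun n => (P n).real {ω | ε < ‖Z n ω‖}) atTop (𝓝 0)

lemma auxTP_zero : auxTP (Ω := Ω) (m := m) P (fun n _ => 0) := by
  intro ε hε
  simp [not_lt.2 hε.le]

lemma auxTP_add {Z W : ∀ n, Ω n → ℂ} (hZ : auxTP (Ω := Ω) (m := m) P Z) (hW : auxTP (Ω := Ω) (m := m) P W) :
    auxTP (Ω := Ω) (m := m) P (fun n ω => Z n ω + W n ω) := by
  intro ε hε
  have := (hZ (ε / 2) (by linarith)).add (hW (ε / 2) (by linarith))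
  rw [add_zero] at this
  refine squeeze_zero (fun n => measureReal_nonneg) (fun n => ?_) this
  refine (measureReal_mono ?_).trans (measureReal_union_le _ _)
  intro ω hω
  simp only [Set.mem_setOf_eq, Set.mem_union] at *
  by_contra! h
  have := norm_add_le (Z n ω) (W n ω)
  linarith

lemma auxTP_mul {Z : ∀ n, Ω n → ℂ} (c : ℂ) (hZ : auxTP (Ω := Ω) (m := m) P Z) :
    auxTP (Ω := Ω) (m := m) P (fun n ω => c * Z n ω) := by
  intro ε hε
  have h0 : 0 < ‖c‖ + 1 := by positivity
  refine squeeze_zero (fun n => measureReal_nonneg) (fun n => ?_) (hZ (ε / (‖c‖ + 1)) (by positivity))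
  refine measureReal_mono ?_
  intro ω hω
  simp only [Set.mem_setOf_eq] at *
  rw [div_lt_iff₀ h0]
  rw [norm_mul] at hω
  nlinarith [norm_nonneg (Z n ω)]

lemma auxTP_sum {Z : ℕ → ∀ n, Ω n → ℂ} (c : ℕ → ℂ) (k : ℕ) (hZ : ∀ l, auxTP (Ω := Ω) (m := m) P (Z l)) :
    auxTP (Ω := Ω) (m := m) P (fun n ω => ∑ l ∈ Finset.range k, c l * Z l n ω) := by
  induction k with
  | zero => simpa using auxTP_zero P
  | succ k ih =>
    simp only [Finset.sum_range_succ]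
    exact auxTP_add P ih (auxTP_mul P (c k) (hZ k))

lemma aux_bdd_above (u : ℕ → ℝ) (h1 : ∀ n, u n ≤ 1) :
    IsBoundedUnder (· ≤ ·) atTop u := isBoundedUnder_of ⟨1, h1⟩

lemma aux_limsup_le (u : ℕ → ℝ) (h0 : ∀ n, 0 ≤ u n) (h1 : ∀ n, u n ≤ 1) :
    limsup u atTop ≤ 1 := by
  have hb : IsBoundedUnder (· ≥ ·) atTop u := isBoundedUnder_of ⟨0, h0⟩
  exact limsup_le_of_le hb.isCoboundedUnder_le (Eventually.of_forall h1)

lemma aux_tendsto (u : ℕ → ℝ) (h0 : ∀ n, 0 ≤ u n) (h1 : ∀ n, u n ≤ 1)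
    (h : limsup u atTop = 0) : Tendsto u atTop (𝓝 0) := by
  have hb := aux_bdd_above u h1
  rw [Metric.tendsto_atTop]
  intro ε hε
  obtain ⟨N, hN⟩ := eventually_atTop.1 (eventually_lt_of_limsup_lt (h.trans_lt hε) hb)
  refine ⟨N, fun n hn => ?_⟩
  rw [Real.dist_eq, sub_zero, abs_of_nonneg (h0 n)]
  exact hN n hn

lemma aux_coef (η : ℝ) (hη : 0 < η) (j k : ℕ) (d : ℝ) (hd : |d| ≤ η / 4) :
    |d| ^ k / (k.factorial : ℝ) ≤
      (j.factorial * 2 ^ j / η ^ j * (1 / 2) ^ k) * (η ^ (j + k) / ((j + k).factorial : ℝ)) := by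
  have h1 : ((j + k).factorial : ℝ) ≤ 2 ^ (j + k) * (j.factorial * k.factorial) := by
    have := Nat.add_choose_mul_factorial_mul_factorial j k
    have h2 := Nat.choose_le_two_pow (j + k) k
    have h3 : (j + k).factorial ≤ 2 ^ (j + k) * (j.factorial * k.factorial) := by
      rw [← this, mul_assoc]
      exact Nat.mul_le_mul_right _ h2
    exact_mod_cast h3
  have hk : (0 : ℝ) < k.factorial := by exact_mod_cast k.factorial_pos
  have hjk : (0 : ℝ) < (j + k).factorial := by exact_mod_cast (j + k).factorial_pos
  have h2 : |d| ^ k ≤ (η / 4) ^ k := by gcongr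
  have e : (j.factorial * 2 ^ j / η ^ j * (1 / 2) ^ k) * (η ^ (j + k) / ((j + k).factorial : ℝ)) =
      (η / 4) ^ k * (2 ^ (j + k) * j.factorial) / ((j + k).factorial : ℝ) := by
    have : (4 : ℝ) ^ k = 2 ^ k * 2 ^ k := by rw [← mul_pow]; norm_num
    rw [div_pow, div_pow, this, pow_add, pow_add]
    field_simp
    simp
  rw [e, div_le_div_iff₀ hk hjk]
  calc |d| ^ k * ((j + k).factorial : ℝ) ≤ (η / 4) ^ k * (2 ^ (j + k) * (j.factorial * k.factorial)) := by
        gcongr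
    _ = _ := by ring

set_option maxHeartbeats 2000000 in
lemma aux_main_step
    (𝒢 : ∀ n, MeasurableSpace (Ω n))
    (X Y : ∀ n, Ω n → ℝ)
    (hX : ∀ n, ∀ k : ℕ, 1 ≤ k → Integrable (fun ω => X n ω ^ k) (P n))
    (hY : ∀ n, ∀ k : ℕ, 1 ≤ k → Integrable (fun ω => Y n ω ^ k) (P n))
    (hclose : ∀ k : ℕ, 1 ≤ k → ∀ ε : ℝ, 0 < ε →
      Tendsto (fun n => (P n).real {ω | ε <
        |((P n)[fun ω => X n ω ^ k | 𝒢 n]) ω -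
          ((P n)[fun ω => Y n ω ^ k | 𝒢 n]) ω|}) atTop (𝓝 0))
    (η : ℝ) (hη : 0 < η)
    (hgrowth : ∀ δ : ℝ, 0 < δ → ∀ᶠ k : ℕ in atTop, ∀ᶠ n in atTop, (P n).real {ω | 1 <
        |η ^ k / (Nat.factorial k : ℝ) *
          ((P n)[fun ω => X n ω ^ k | 𝒢 n]) ω|} < δ)
    (s t : ℝ) (hst : |t - s| ≤ η / 4)
    (hs : ∀ j, auxTP (Ω := Ω) (m := m) P (fun n => auxD (P n) (𝒢 n) (X n) (Y n) j s)) (j : ℕ) :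
    auxTP (Ω := Ω) (m := m) P (fun n => auxD (P n) (𝒢 n) (X n) (Y n) j t) := by
  intro ε hε
  rw [Metric.tendsto_atTop]
  intro δ hδ
  obtain ⟨K1, hK1⟩ := eventually_atTop.1 (hgrowth (δ / 3) (by linarith))
  have hlim : Tendsto (fun k : ℕ => (j.factorial * 2 ^ j / η ^ j * (1 / 2) ^ k : ℝ)) atTop (𝓝 0) := by
    have := (tendsto_pow_atTop_nhds_zero_of_lt_one (r := (1 / 2 : ℝ)) (by norm_num)
      (by norm_num)).const_mul (j.factorial * 2 ^ j / η ^ j : ℝ)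
    simpa using this
  obtain ⟨K2, hK2⟩ := eventually_atTop.1 (hlim.eventually (gt_mem_nhds (show 0 < ε / 4 by linarith)))
  obtain ⟨k, hk1, hk2, hk3, hev⟩ : ∃ k, K1 ≤ j + k ∧ K2 ≤ k ∧ 1 ≤ j + k ∧ Even (j + k) :=
    ⟨j + 2 * (K1 + K2 + 1), by omega, by omega, by omega, ⟨j + (K1 + K2 + 1), by omega⟩⟩
  set a : ℝ := |t - s| ^ k / (k.factorial : ℝ) with ha
  have ha0 : 0 ≤ a := by positivity
  have hcoef := aux_coef η hη j k (t - s) hst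
  set q : ℝ := η ^ (j + k) / ((j + k).factorial : ℝ) with hq
  have hq0 : 0 < q := by positivity
  have haq : a ≤ ε / 4 * q := hcoef.trans (by gcongr; exact (hK2 k hk2).le)
  have hZ := auxTP_sum (Ω := Ω) (m := m) P (Z := fun l n => auxD (P n) (𝒢 n) (X n) (Y n) (j + l) s)
    (auxC s t) k (fun l => hs (j + l)) (ε / 4) (by linarith)
  have hC := hclose (j + k) hk3 (ε / (4 * (a + 1))) (by positivity)
  have hG := hK1 (j + k) hk1
  have hZ' := hZ.eventually (gt_mem_nhds (show 0 < δ / 3 by linarith))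
  have hC' := hC.eventually (gt_mem_nhds (show 0 < δ / 3 by linarith))
  obtain ⟨N, hN⟩ := eventually_atTop.1 (hZ'.and (hC'.and hG))
  refine ⟨N, fun n hn => ?_⟩
  obtain ⟨b1, b2, b3⟩ := hN n hn
  rw [Real.dist_eq, sub_zero, abs_of_nonneg measureReal_nonneg]
  have hstep := auxD_step (P n) (𝒢 n) (X n) (Y n) (hX n) (hY n) j k s t hk3 hev
  set U := (P n)[fun ω => X n ω ^ (j + k) | 𝒢 n] with hU
  set V := (P n)[fun ω => Y n ω ^ (j + k) | 𝒢 n] with hV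
  set S1 := {ω | ε / 4 < ‖∑ l ∈ Finset.range k, auxC s t l *
    auxD (P n) (𝒢 n) (X n) (Y n) (j + l) s ω‖} with hS1
  set S2 := {ω | ε / (4 * (a + 1)) < |U ω - V ω|} with hS2
  set S3 := {ω | 1 < |q * U ω|} with hS3
  have hle : (P n).real {ω | ε < ‖auxD (P n) (𝒢 n) (X n) (Y n) j t ω‖} ≤
      (P n).real (S1 ∪ (S2 ∪ S3)) := by
    refine ENNReal.toReal_mono (measure_ne_top _ _) (measure_mono_ae ?_)
    filter_upwards [hstep] with ω h1 hω
    have hω : ε < ‖auxD (P n) (𝒢 n) (X n) (Y n) j t ω‖ := hω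
    by_contra hcon
    have hcon' : ¬ (ε / 4 < ‖∑ l ∈ Finset.range k, auxC s t l *
        auxD (P n) (𝒢 n) (X n) (Y n) (j + l) s ω‖ ∨ (ε / (4 * (a + 1)) < |U ω - V ω| ∨
        1 < |q * U ω|)) := hcon
    push Not at hcon'
    obtain ⟨c1, c2, c3⟩ := hcon'
    rw [le_div_iff₀ (by positivity)] at c2
    have c4 : a * |U ω| ≤ ε / 4 := by
      rw [abs_mul, abs_of_pos hq0] at c3
      calc a * |U ω| ≤ ε / 4 * q * |U ω| := by gcongr
        _ = ε / 4 * (q * |U ω|) := by ring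
        _ ≤ ε / 4 * 1 := by gcongr
        _ = _ := by ring
    have c5 : a * (U ω + V ω) ≤ 2 * (a * |U ω|) + a * |U ω - V ω| := by
      have : U ω + V ω ≤ 2 * |U ω| + |U ω - V ω| := by
        linarith [le_abs_self (U ω), neg_abs_le (U ω - V ω)]
      nlinarith
    have c6 : 4 * (a * |U ω - V ω|) ≤ ε := by nlinarith [abs_nonneg (U ω - V ω)]
    linarith
  have := measureReal_union_le (μ := P n) S1 (S2 ∪ S3)
  have := measureReal_union_le (μ := P n) S2 S3
  linarith

end seq




/-- Lemma on conditional convergence implying unconditional convergence: if the conditional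
moments of X_n and Y_n given sub-σ-fields 𝒢_n are asymptotically close in probability, and the
conditional moments of X_n satisfy a uniform growth condition, then the characteristic
functions of X_n and Y_n are asymptotically equal. -/
theorem stmt16 (Ω : ℕ → Type) [m : ∀ n, MeasurableSpace (Ω n)]
    (P : ∀ n, Measure (Ω n)) [∀ n, IsProbabilityMeasure (P n)]
    (𝒢 : ∀ n, MeasurableSpace (Ω n)) (h𝒢 : ∀ n, 𝒢 n ≤ m n)
    (X Y : ∀ n, Ω n → ℝ)
    (hX : ∀ n, ∀ k : ℕ, 1 ≤ k → Integrable (fun ω => X n ω ^ k) (P n))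
    (hY : ∀ n, ∀ k : ℕ, 1 ≤ k → Integrable (fun ω => Y n ω ^ k) (P n))
    -- (a) the conditional moments are asymptotically close in probability:
    (hclose : ∀ k : ℕ, 1 ≤ k → ∀ ε : ℝ, 0 < ε →
      limsup (fun n => ((P n) {ω | ε <
        |((P n)[fun ω => X n ω ^ k | 𝒢 n]) ω -
          ((P n)[fun ω => Y n ω ^ k | 𝒢 n]) ω|}).toReal) atTop = 0)
    -- (b) the uniform growth condition on the conditional moments of X_n:
    (η : ℝ) (hη : 0 < η)
    (hgrowth : ∀ ε : ℝ, 0 < ε →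
      limsup (fun k : ℕ => limsup (fun n => ((P n) {ω | ε <
        |η ^ k / (Nat.factorial k : ℝ) *
          ((P n)[fun ω => X n ω ^ k | 𝒢 n]) ω|}).toReal) atTop) atTop = 0) :
    ∀ t : ℝ, Tendsto (fun n =>
      (∫ ω, Complex.exp ((t * X n ω : ℝ) * Complex.I) ∂(P n)) -
      (∫ ω, Complex.exp ((t * Y n ω : ℝ) * Complex.I) ∂(P n))) atTop (𝓝 0) := by
  have hclose' : ∀ k : ℕ, 1 ≤ k → ∀ ε : ℝ, 0 < ε →
      Tendsto (fun n => (P n).real {ω | ε <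
        |((P n)[fun ω => X n ω ^ k | 𝒢 n]) ω -
          ((P n)[fun ω => Y n ω ^ k | 𝒢 n]) ω|}) atTop (𝓝 0) := fun k hk ε hε =>
    aux_tendsto _ (fun n => measureReal_nonneg) (fun n => measureReal_le_one) (hclose k hk ε hε)
  have hgrowth' : ∀ δ : ℝ, 0 < δ → ∀ᶠ k : ℕ in atTop, ∀ᶠ n in atTop, (P n).real {ω | 1 <
        |η ^ k / (Nat.factorial k : ℝ) *
          ((P n)[fun ω => X n ω ^ k | 𝒢 n]) ω|} < δ := by
    intro δ hδ
    have hb : ∀ k : ℕ, IsBoundedUnder (· ≤ ·) atTop (fun n => (P n).real {ω | 1 <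
        |η ^ k / (Nat.factorial k : ℝ) * ((P n)[fun ω => X n ω ^ k | 𝒢 n]) ω|}) := fun k =>
      aux_bdd_above _ (fun n => measureReal_le_one)
    have h := eventually_lt_of_limsup_lt ((hgrowth 1 one_pos).trans_lt hδ)
      (aux_bdd_above _ (fun k => aux_limsup_le _ (fun n => measureReal_nonneg)
        (fun n => measureReal_le_one)))
    filter_upwards [h] with k hk
    exact eventually_lt_of_limsup_lt hk (hb k)
  have key : ∀ N : ℕ, ∀ t : ℝ, |t| ≤ N * (η / 4) →
      ∀ j, auxTP (Ω := Ω) (m := m) P (fun n => auxD (P n) (𝒢 n) (X n) (Y n) j t) := by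
    intro N
    induction N with
    | zero =>
      intro t ht j
      have ht0 : t = 0 := by simpa using ht
      subst ht0
      rcases Nat.eq_zero_or_pos j with rfl | hj
      · have : (fun n => auxD (P n) (𝒢 n) (X n) (Y n) 0 0) = fun n _ => 0 := by
          funext n ω
          have : (fun ω => auxF 0 0 (X n ω) - auxF 0 0 (Y n ω)) = 0 := by
            funext ω; simp [auxF]
          simp [auxD, this]
        rw [this]
        exact auxTP_zero (Ω := Ω) (m := m) P
      · intro ε hε
        refine (hclose' j hj ε hε).congr fun n => ?_
        have h1 := (Complex.ofRealCLM).comp_condExp_comm (μ := P n) (m := 𝒢 n)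
          ((hX n j hj).sub (hY n j hj))
        have h2 := condExp_sub (hX n j hj) (hY n j hj) (𝒢 n)
        have h3 : (fun ω => auxF j 0 (X n ω) - auxF j 0 (Y n ω)) =
            Complex.ofRealCLM ∘ ((fun ω => X n ω ^ j) - (fun ω => Y n ω ^ j)) := by
          funext ω; simp [auxF]
        refine measureReal_congr ?_
        filter_upwards [h1, h2] with ω h1 h2
        have h4 : auxD (P n) (𝒢 n) (X n) (Y n) j 0 ω =
            ((((P n)[fun ω => X n ω ^ j | 𝒢 n]) ω -
              ((P n)[fun ω => Y n ω ^ j | 𝒢 n]) ω : ℝ) : ℂ) := by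
          unfold auxD
          rw [h3, ← h1]
          simp only [Function.comp_apply, h2]
          simp
        change (ε < _) = (ε < _)
        rw [h4, Complex.norm_real, Real.norm_eq_abs]
    | succ N ih =>
      intro t ht j
      have hN : (0 : ℝ) < N + 1 := by positivity
      push_cast at ht
      refine aux_main_step (Ω := Ω) (m := m) P 𝒢 X Y hX hY hclose' η hη hgrowth' (t * (N / (N + 1))) t ?_ (ih _ ?_) j
      · have : t - t * (N / (N + 1)) = t / (N + 1) := by field_simp; ring
        rw [this, abs_div, abs_of_pos hN, div_le_iff₀ hN]
        linarith
      · rw [abs_mul, abs_of_nonneg (by positivity : (0 : ℝ) ≤ N / (N + 1))]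
        calc |t| * (N / (N + 1)) ≤ ((N + 1) * (η / 4)) * (N / (N + 1)) := by gcongr
          _ = _ := by field_simp
  intro t
  obtain ⟨N, hN⟩ := exists_nat_ge (|t| / (η / 4))
  have ht := key N t (by rwa [div_le_iff₀ (by positivity)] at hN) 0
  rw [Metric.tendsto_atTop]
  intro ε hε
  obtain ⟨M, hM⟩ := eventually_atTop.1 ((ht (ε / 2) (by linarith)).eventually
    (gt_mem_nhds (show 0 < ε / 4 by linarith)))
  refine ⟨M, fun n hn => ?_⟩
  rw [dist_zero_right]
  have := auxD_int (P n) (𝒢 n) (h𝒢 n) (X n) (Y n) (hX n) (hY n) t (ε / 2) (by linarith)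
  have := hM n hn
  linarith
end

section
/- Let c_n → ∞, let E_n be nonnegative-integer-valued random variables with E_n/c_n converging in distribution to a nonnegative random variable Z, and let M_n be a random variable whose conditional distribution given E_n is Binomial(E_n, 1/c_n). Then M_n converges in distribution to a random variable with the Poisson mixture distribution Poisson(Z). Moreover, for every real t and every ε > 0, limsup_{k→∞} limsup_{n→∞} P(|t^k/k! · E(M_n^k | E_n)| > ε) = 0. -/
open MeasureTheory ProbabilityTheory Filter
open scoped ENNReal NNReal Topology BoundedContinuousFunction

/-- The binomial probability mass function with m trials and success probability p. -/
noncomputable def binomPMF (m : ℕ) (p : ℝ) (k : ℕ) : ℝ :=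
  (m.choose k : ℝ) * p ^ k * (1 - p) ^ (m - k)

lemma binomPMF_nonneg (m : ℕ) (p : ℝ) (k : ℕ) (h0 : 0 ≤ p) (h1 : p ≤ 1) : 0 ≤ binomPMF m p k := by
  unfold binomPMF
  have : 0 ≤ 1 - p := by linarith
  positivity

lemma binomPMF_zero_of_lt (m : ℕ) (p : ℝ) (k : ℕ) (h : m < k) : binomPMF m p k = 0 := by
  unfold binomPMF
  simp [Nat.choose_eq_zero_of_lt h]

lemma binomPMF_mgf (m : ℕ) (p y : ℝ) :
    ∑ j ∈ Finset.range (m + 1), binomPMF m p j * y ^ j = (p * y + (1 - p)) ^ m := by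
  rw [add_pow]
  refine Finset.sum_congr rfl fun j _ => ?_
  unfold binomPMF
  rw [mul_pow]; ring

lemma binomPMF_le_one (m : ℕ) (p : ℝ) (k : ℕ) (h0 : 0 ≤ p) (h1 : p ≤ 1) : binomPMF m p k ≤ 1 := by
  rcases lt_or_ge m k with h | h
  · rw [binomPMF_zero_of_lt m p k h]; norm_num
  · have := binomPMF_mgf m p 1
    simp only [one_pow, mul_one, add_sub_cancel] at this
    rw [← this]
    exact Finset.single_le_sum (f := fun j => binomPMF m p j)
      (fun j _ => binomPMF_nonneg m p j h0 h1) (Finset.mem_range.2 (by omega))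

lemma binomPMF_succ_zero (m : ℕ) (p : ℝ) :
    binomPMF (m + 1) p 0 = (1 - p) * binomPMF m p 0 := by
  simp [binomPMF, pow_succ, mul_comm]

lemma binomPMF_succ_succ (m : ℕ) (p : ℝ) (k : ℕ) :
    binomPMF (m + 1) p (k + 1) = (1 - p) * binomPMF m p (k + 1) + p * binomPMF m p k := by
  unfold binomPMF
  rcases lt_or_ge m (k + 1) with h | h
  · rw [Nat.choose_succ_succ, Nat.choose_eq_zero_of_lt h]
    have : m + 1 - (k + 1) = m - k := by omega
    rw [this]; push_cast; ring
  · rw [Nat.choose_succ_succ]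
    obtain ⟨d, rfl⟩ := Nat.exists_eq_add_of_le h
    have h1 : k + 1 + d + 1 - (k + 1) = d + 1 := by omega
    have h2 : k + 1 + d - (k + 1) = d := by omega
    have h3 : k + 1 + d - k = d + 1 := by omega
    rw [h1, h2, h3]; push_cast; ring

/-- Poisson weights. -/
noncomputable def poisW (k : ℕ) (x : ℝ) : ℝ := Real.exp (-x) * x ^ k / (Nat.factorial k : ℝ)

lemma poisW_nonneg (k : ℕ) (x : ℝ) (hx : 0 ≤ x) : 0 ≤ poisW k x := by
  unfold poisW; positivity

lemma poisW_le_one (k : ℕ) (x : ℝ) (hx : 0 ≤ x) : poisW k x ≤ 1 := by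
  unfold poisW
  have := Real.pow_div_factorial_le_exp x hx k
  rw [mul_div_assoc, Real.exp_neg]
  rw [inv_mul_le_iff₀ (Real.exp_pos x)]
  simpa using this

/-- Derivatives of Poisson weights. -/
noncomputable def poisD : ℕ → ℝ → ℝ
  | 0, x => - poisW 0 x
  | (k + 1), x => poisW k x - poisW (k + 1) x

lemma poisW_hasDeriv (k : ℕ) (x : ℝ) : HasDerivAt (poisW k) (poisD k x) x := by
  have he : HasDerivAt (fun x : ℝ => Real.exp (-x)) (-Real.exp (-x)) x := by
    simpa using (hasDerivAt_neg x).exp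
  cases k with
  | zero =>
    have : poisW 0 = fun x => Real.exp (-x) := by ext; simp [poisW]
    simp only [poisD, this]; exact he
  | succ k =>
    have h := (he.mul (hasDerivAt_pow (k + 1) x)).div_const ((Nat.factorial (k + 1) : ℕ) : ℝ)
    refine h.congr_deriv ?_
    simp only [poisD, poisW, Nat.factorial_succ]
    push_cast
    have : (Nat.factorial k : ℝ) ≠ 0 := by positivity
    have : (k + 1 : ℝ) ≠ 0 := by positivity
    field_simp
    try simp
    try ring

lemma poisD_abs (k : ℕ) (x : ℝ) (hx : 0 ≤ x) : |poisD k x| ≤ 1 := by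
  cases k with
  | zero => 
    have := poisW_nonneg 0 x hx; have := poisW_le_one 0 x hx
    simp only [poisD]; rw [abs_le]; constructor <;> linarith
  | succ k =>
    have := poisW_nonneg k x hx; have := poisW_le_one k x hx
    have := poisW_nonneg (k+1) x hx; have := poisW_le_one (k+1) x hx
    simp only [poisD]; rw [abs_le]; constructor <;> linarith

lemma poisW_mvt (k : ℕ) (x y : ℝ) (hxy : x < y) :
    ∃ z ∈ Set.Ioo x y, poisW k y - poisW k x = poisD k z * (y - x) := by
  obtain ⟨z, hz, h⟩ := exists_hasDerivAt_eq_slope (poisW k) (poisD k) hxy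
    (fun z _ => (poisW_hasDeriv k z).continuousAt.continuousWithinAt)
    (fun z _ => poisW_hasDeriv k z)
  refine ⟨z, hz, ?_⟩
  rw [h]; field_simp [sub_ne_zero.2 hxy.ne']

lemma poisW_lip (k : ℕ) (x y : ℝ) (hx : 0 ≤ x) (hxy : x < y) :
    |poisW k y - poisW k x| ≤ y - x := by
  obtain ⟨z, hz, h⟩ := poisW_mvt k x y hxy
  rw [h, abs_mul, abs_of_pos (sub_pos.2 hxy)]
  have := poisD_abs k z (hx.trans hz.1.le)
  nlinarith

lemma poisD_lip (k : ℕ) (x y : ℝ) (hx : 0 ≤ x) (hxy : x < y) :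
    |poisD k y - poisD k x| ≤ 2 * (y - x) := by
  cases k with
  | zero =>
    have h := poisW_lip 0 x y hx hxy
    simp only [poisD]; rw [abs_le] at h ⊢; constructor <;> linarith
  | succ k =>
    have h := poisW_lip k x y hx hxy
    have h' := poisW_lip (k+1) x y hx hxy
    simp only [poisD]; rw [abs_le] at h h' ⊢; constructor <;> linarith

lemma poisW_taylor (k : ℕ) (x p : ℝ) (hx : 0 ≤ x) (hp : 0 ≤ p) :
    |poisW k (x + p) - poisW k x - p * poisD k x| ≤ 2 * p ^ 2 := by
  rcases hp.eq_or_lt with rfl | hp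
  · simp
  obtain ⟨z, hz, h⟩ := poisW_mvt k x (x + p) (by linarith)
  have h2 := poisD_lip k x z hx hz.1
  rw [h]
  have : poisD k z * (x + p - x) - p * poisD k x = p * (poisD k z - poisD k x) := by ring
  rw [this, abs_mul, abs_of_pos hp]
  have := hz.2
  nlinarith

lemma binom_pois (p : ℝ) (h0 : 0 ≤ p) (h1 : p ≤ 1) (m : ℕ) : ∀ k,
    |binomPMF m p k - poisW k (m * p)| ≤ 2 * (m * p ^ 2) := by
  induction m with
  | zero =>
    intro k
    cases k <;> simp [binomPMF, poisW]
  | succ m ih =>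
    intro k
    have hx : 0 ≤ (m : ℝ) * p := by positivity
    have ht := poisW_taylor k (m * p) p hx h0
    have e : ((m + 1 : ℕ) : ℝ) * p = m * p + p := by push_cast; ring
    have hq : 0 ≤ 1 - p := by linarith
    rw [e]
    push_cast
    cases k with
    | zero =>
      rw [binomPMF_succ_zero]
      simp only [poisD] at ht
      have i0 := abs_le.1 (ih 0)
      have ht := abs_le.1 ht
      have : (0:ℝ) ≤ m * p^2 := by positivity
      rw [abs_le]
      constructor <;> nlinarith [mul_le_mul_of_nonneg_left i0.1 hq, mul_le_mul_of_nonneg_left i0.2 hq]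
    | succ k =>
      rw [binomPMF_succ_succ]
      simp only [poisD] at ht
      have i0 := abs_le.1 (ih k)
      have i1 := abs_le.1 (ih (k+1))
      have ht := abs_le.1 ht
      rw [abs_le]
      constructor <;> nlinarith [mul_le_mul_of_nonneg_left i1.1 hq, mul_le_mul_of_nonneg_left i1.2 hq, mul_le_mul_of_nonneg_left i0.1 h0, mul_le_mul_of_nonneg_left i0.2 h0]

lemma binom_moment (p : ℝ) (h0 : 0 ≤ p) (h1 : p ≤ 1) (m k : ℕ) (t : ℝ) :
    |t ^ k / (Nat.factorial k : ℝ) * ∑ j ∈ Finset.range (m + 1), (j : ℝ) ^ k * binomPMF m p j|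
      ≤ (1 / 2) ^ k * Real.exp (m * p * Real.exp (2 * |t|)) := by
  have hS : 0 ≤ ∑ j ∈ Finset.range (m + 1), (j : ℝ) ^ k * binomPMF m p j :=
    Finset.sum_nonneg fun j _ => mul_nonneg (by positivity) (binomPMF_nonneg m p j h0 h1)
  rw [abs_mul, abs_of_nonneg hS, abs_div, abs_pow, Nat.abs_cast, Finset.mul_sum]
  have key : ∀ j : ℕ, |t| ^ k / (Nat.factorial k : ℝ) * ((j : ℝ) ^ k * binomPMF m p j) ≤
      (1 / 2) ^ k * (binomPMF m p j * Real.exp (2 * |t|) ^ j) := by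
    intro j
    have h := Real.pow_div_factorial_le_exp (j * (2 * |t|)) (by positivity) k
    rw [Real.exp_nat_mul] at h
    have hb := binomPMF_nonneg m p j h0 h1
    calc |t| ^ k / (Nat.factorial k : ℝ) * ((j : ℝ) ^ k * binomPMF m p j)
        = (1 / 2) ^ k * (binomPMF m p j * ((j * (2 * |t|)) ^ k / (Nat.factorial k : ℝ))) := by
          rw [mul_pow, mul_pow, div_pow, one_pow]; field_simp
      _ ≤ _ := by gcongr
  refine (Finset.sum_le_sum fun j _ => key j).trans ?_
  rw [← Finset.mul_sum, binomPMF_mgf]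
  gcongr
  rw [mul_assoc, Real.exp_nat_mul]
  have := Real.exp_pos (2 * |t|)
  gcongr
  have := Real.add_one_le_exp (p * Real.exp (2 * |t|))
  linarith

lemma prob_M {Ω : Type} [MeasurableSpace Ω] (μ : Measure Ω) [IsProbabilityMeasure μ]
    (p : ℝ) (h0 : 0 ≤ p) (h1 : p ≤ 1) (E M : Ω → ℕ) (hE : Measurable E) (hM : Measurable M)
    (hbin : ∀ m k, μ {ω | E ω = m ∧ M ω = k} =
      μ {ω | E ω = m} * ENNReal.ofReal (binomPMF m p k)) (k : ℕ) :
    (μ {ω | M ω = k}).toReal = ∫ ω, binomPMF (E ω) p k ∂μ := by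
  rw [integral_eq_lintegral_of_nonneg_ae (ae_of_all _ fun ω => binomPMF_nonneg _ p k h0 h1)
    ((measurable_from_top (f := fun m : ℕ => binomPMF m p k)).comp hE).aestronglyMeasurable]
  congr 1
  have hu : {ω | M ω = k} = ⋃ m, {ω | E ω = m ∧ M ω = k} := by
    ext ω; simp
  rw [hu, measure_iUnion]
  · rw [← lintegral_map (f := fun m : ℕ => ENNReal.ofReal (binomPMF m p k)) measurable_from_top hE,
      lintegral_countable']
    refine tsum_congr fun m => ?_
    rw [hbin, mul_comm, Measure.map_apply hE (measurableSet_singleton m)]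
    rfl
  · intro a b hab
    refine Set.disjoint_left.2 ?_
    rintro ω ⟨h, _⟩ ⟨h', _⟩
    exact hab (h.symm.trans h')
  · intro m
    exact (hE (measurableSet_singleton m)).inter (hM (measurableSet_singleton k))

lemma setInt_M {Ω : Type} [MeasurableSpace Ω] (μ : Measure Ω) [IsProbabilityMeasure μ]
    (p : ℝ) (h0 : 0 ≤ p) (h1 : p ≤ 1) (E M : Ω → ℕ) (hE : Measurable E) (hM : Measurable M)
    (hbin : ∀ m k, μ {ω | E ω = m ∧ M ω = k} =
      μ {ω | E ω = m} * ENNReal.ofReal (binomPMF m p k)) (f : ℕ → ℝ) (m : ℕ) :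
    ∫ ω in {ω | E ω = m}, f (M ω) ∂μ =
      μ.real {ω | E ω = m} * ∑ j ∈ Finset.range (m + 1), f j * binomPMF m p j := by
  have hS : ∀ m, MeasurableSet {ω | E ω = m} := fun m => hE (measurableSet_singleton m)
  have hT : ∀ m, MeasurableSet {ω | M ω = m} := fun m => hM (measurableSet_singleton m)
  have hle : ∀ᵐ ω ∂(μ.restrict {ω | E ω = m}), M ω ≤ m := by
    rw [ae_restrict_iff' (hS m)]
    have : ∀ k, m < k → ∀ᵐ ω ∂μ, ¬ (E ω = m ∧ M ω = k) := by
      intro k hk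
      rw [ae_iff]
      simp only [not_not]
      rw [hbin, binomPMF_zero_of_lt m p k hk]; simp
    have h2 : ∀ᵐ ω ∂μ, ∀ k, m < k → ¬ (E ω = m ∧ M ω = k) :=
      ae_all_iff.2 fun k => ae_all_iff.2 (this k)
    filter_upwards [h2] with ω h hω
    by_contra hcon
    exact h (M ω) (by omega) ⟨hω, rfl⟩
  have heq : ∫ ω in {ω | E ω = m}, f (M ω) ∂μ = ∫ ω in {ω | E ω = m},
      ∑ j ∈ Finset.range (m + 1), Set.indicator {ω | M ω = j} (fun _ => f j) ω ∂μ := by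
    refine integral_congr_ae ?_
    filter_upwards [hle] with ω h
    rw [Finset.sum_eq_single (M ω)]
    · simp
    · intro j _ hj
      simp [Ne.symm hj]
    · intro h'
      exact absurd (Finset.mem_range.2 (by omega)) h'
  rw [heq, integral_finsetSum _ fun j _ => (integrable_const (f j)).indicator (hT j), Finset.mul_sum]
  refine Finset.sum_congr rfl fun j _ => ?_
  rw [integral_indicator_const _ (hT j), measureReal_restrict_apply (hT j)]
  have : {ω | M ω = j} ∩ {ω | E ω = m} = {ω | E ω = m ∧ M ω = j} := by
    ext ω; simp [and_comm]
  rw [this, measureReal_def, hbin, ENNReal.toReal_mul, ENNReal.toReal_ofReal (binomPMF_nonneg m p j h0 h1),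
    smul_eq_mul, measureReal_def]
  ring

lemma condExp_M {Ω : Type} [MeasurableSpace Ω] (μ : Measure Ω) [IsProbabilityMeasure μ]
    (p : ℝ) (h0 : 0 ≤ p) (h1 : p ≤ 1) (E M : Ω → ℕ) (hE : Measurable E) (hM : Measurable M)
    (hbin : ∀ m k, μ {ω | E ω = m ∧ M ω = k} =
      μ {ω | E ω = m} * ENNReal.ofReal (binomPMF m p k)) (k : ℕ) (t : ℝ) :
    ∀ᵐ ω ∂μ, |t ^ k / (Nat.factorial k : ℝ) *
          ((μ[fun ω => (M ω : ℝ) ^ k | MeasurableSpace.comap E inferInstance]) ω)| ≤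
      (1 / 2) ^ k * Real.exp (E ω * p * Real.exp (2 * |t|)) := by
  by_cases hint : Integrable (fun ω => (M ω : ℝ) ^ k) μ
  swap
  · rw [condExp_of_not_integrable hint]
    refine ae_of_all _ fun ω => ?_
    simp only [Pi.zero_apply, mul_zero, abs_zero]
    positivity
  have hm : MeasurableSpace.comap E inferInstance ≤ (inferInstance : MeasurableSpace Ω) := hE.comap_le
  obtain ⟨h, hh, hcomp⟩ := (stronglyMeasurable_condExp (μ := μ) (m := MeasurableSpace.comap E inferInstance) (f := fun ω => (M ω : ℝ) ^ k)).measurable.exists_eq_measurable_comp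
  have hS : ∀ m, MeasurableSet {ω | E ω = m} := fun m => hE (measurableSet_singleton m)
  have hval : ∀ m, μ {ω | E ω = m} ≠ 0 →
      h m = ∑ j ∈ Finset.range (m + 1), (j : ℝ) ^ k * binomPMF m p j := by
    intro m hm0
    have e1 := setIntegral_condExp hm hint (s := {ω | E ω = m}) ⟨{m}, measurableSet_singleton m, rfl⟩
    rw [setInt_M μ p h0 h1 E M hE hM hbin (fun j => (j : ℝ) ^ k) m] at e1
    have e2 : ∫ ω in {ω | E ω = m}, (μ[fun ω => (M ω : ℝ) ^ k | MeasurableSpace.comap E inferInstance]) ω ∂μ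
        = ∫ ω in {ω | E ω = m}, h m ∂μ := by
      refine setIntegral_congr_fun (hS m) ?_
      intro ω hω
      have : E ω = m := hω
      simp only [hcomp, Function.comp, this]
    rw [e2, setIntegral_const, smul_eq_mul] at e1
    refine mul_left_cancel₀ ?_ e1
    rw [measureReal_def]
    exact (ENNReal.toReal_pos hm0 (measure_ne_top _ _)).ne'
  have hpos : ∀ᵐ ω ∂μ, ∀ m, μ {ω | E ω = m} = 0 → E ω ≠ m := by
    refine ae_all_iff.2 fun m => ae_all_iff.2 fun h => ?_
    rw [ae_iff]; simpa using h
  filter_upwards [hpos] with ω hω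
  have h3 : μ {ω' | E ω' = E ω} ≠ 0 := fun h => hω _ h rfl
  rw [hcomp]
  simp only [Function.comp]
  rw [hval _ h3]
  exact binom_moment p h0 h1 (E ω) k t

/-- Truncated linear test function. -/
noncomputable def truncF (δ : ℝ) : ℝ →ᵇ ℝ :=
  BoundedContinuousFunction.ofNormedAddCommGroup (fun x => min 1 (|δ * x|)) (by fun_prop) 1 (by
    intro x
    rw [Real.norm_eq_abs, abs_of_nonneg (by positivity)]
    exact min_le_left _ _)

noncomputable def poisF (k : ℕ) : ℝ →ᵇ ℝ :=
  BoundedContinuousFunction.ofNormedAddCommGroup (fun x => poisW k |x|) (by unfold poisW; fun_prop) 1 (by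
    intro x
    rw [Real.norm_eq_abs, abs_of_nonneg (poisW_nonneg _ _ (abs_nonneg _))]
    exact poisW_le_one _ _ (abs_nonneg _))

lemma tight {Ω : Type} [MeasurableSpace Ω] (μ : Measure Ω) [IsProbabilityMeasure μ]
    (X : ℕ → Ω → ℝ)
    {Ω' : Type} [MeasurableSpace Ω'] (μ' : Measure Ω') [IsProbabilityMeasure μ']
    (Z : Ω' → ℝ) (hZmeas : Measurable Z)
    (hconv : ∀ f : ℝ →ᵇ ℝ,
      Tendsto (fun n => ∫ ω, f (X n ω) ∂μ) atTop
        (𝓝 (∫ ω, f (Z ω) ∂μ'))) (η : ℝ) (hη : 0 < η) :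
    ∃ δ > 0, ∀ᶠ n in atTop, ∫ ω, min 1 (|δ * X n ω|) ∂μ < η := by
  have hlim : Tendsto (fun i : ℕ => ∫ ω, min 1 (|(1 / ((i : ℝ) + 1)) * Z ω|) ∂μ') atTop (𝓝 (∫ ω, (0 : ℝ) ∂μ')) := by
    refine tendsto_integral_of_dominated_convergence (fun _ => 1) ?_ (integrable_const _) ?_ ?_
    · intro i
      exact (Measurable.aestronglyMeasurable (by fun_prop))
    · intro i
      refine ae_of_all _ fun ω => ?_
      rw [Real.norm_eq_abs, abs_of_nonneg (by positivity)]
      exact min_le_left _ _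
    · refine ae_of_all _ fun ω => ?_
      have h := (tendsto_one_div_add_atTop_nhds_zero_nat (𝕜 := ℝ)).mul_const (Z ω)
      have := (tendsto_const_nhds (x := (1 : ℝ))).min h.abs
      simpa using this
  rw [integral_zero] at hlim
  obtain ⟨i, hi⟩ := (hlim.eventually (gt_mem_nhds hη)).exists
  refine ⟨1 / ((i : ℝ) + 1), by positivity, ?_⟩
  exact (hconv (truncF (1 / ((i : ℝ) + 1)))).eventually (gt_mem_nhds hi)

/-- If c_n → ∞, E_n/c_n converges in distribution to a nonnegative random variable Z, and M_n
has conditional distribution Binomial(E_n, 1/c_n) given E_n, then M_n converges in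
distribution to the Poisson mixture Poisson(Z); moreover for every t and ε > 0,
limsup_k limsup_n P(|t^k/k! · E(M_n^k | E_n)| > ε) = 0. -/
theorem stmt19 {Ω : Type} [MeasurableSpace Ω] (μ : Measure Ω) [IsProbabilityMeasure μ]
    (c : ℕ → ℕ) (hc : Tendsto c atTop atTop)
    (E M : ℕ → Ω → ℕ)
    (hEmeas : ∀ n, Measurable (E n)) (hMmeas : ∀ n, Measurable (M n))
    -- the conditional distribution of M_n given E_n is Binomial(E_n, 1/c_n):
    (hbin : ∀ n m k, μ {ω | E n ω = m ∧ M n ω = k} =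
      μ {ω | E n ω = m} * ENNReal.ofReal (binomPMF m (1 / (c n : ℝ)) k))
    {Ω' : Type} [MeasurableSpace Ω'] (μ' : Measure Ω') [IsProbabilityMeasure μ']
    (Z : Ω' → ℝ) (hZmeas : Measurable Z) (hZ0 : ∀ᵐ ω ∂μ', 0 ≤ Z ω)
    -- E_n/c_n converges in distribution to Z:
    (hconv : ∀ f : ℝ →ᵇ ℝ,
      Tendsto (fun n => ∫ ω, f ((E n ω : ℝ) / (c n : ℝ)) ∂μ) atTop
        (𝓝 (∫ ω, f (Z ω) ∂μ'))) :
    -- M_n converges in distribution to the Poisson mixture Poisson(Z):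
    (∀ k : ℕ, Tendsto (fun n => (μ {ω | M n ω = k}).toReal) atTop
      (𝓝 (∫ ω, Real.exp (-(Z ω)) * Z ω ^ k / (Nat.factorial k : ℝ) ∂μ'))) ∧
    -- the uniform growth condition on the conditional moments of M_n:
    (∀ t : ℝ, ∀ ε : ℝ, 0 < ε →
      limsup (fun k : ℕ => limsup (fun n => (μ {ω | ε <
        |t ^ k / (Nat.factorial k : ℝ) *
          ((μ[fun ω => (M n ω : ℝ) ^ k | MeasurableSpace.comap (E n) inferInstance]) ω)|}).toReal)
        atTop) atTop = 0) := by
  have hp0 : ∀ n, 0 ≤ 1 / (c n : ℝ) := fun n => by positivity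
  have hp1 : ∀ n, 1 / (c n : ℝ) ≤ 1 := by
    intro n
    rcases Nat.eq_zero_or_pos (c n) with h | h
    · simp [h]
    · have : (1 : ℝ) ≤ c n := by exact_mod_cast h
      exact (div_le_one (by linarith)).2 this
  have hXm : ∀ n, Measurable fun ω => (E n ω : ℝ) / (c n : ℝ) := fun n =>
    ((measurable_from_top (f := fun m : ℕ => (m : ℝ))).comp (hEmeas n)).div_const _
  have htight := tight μ (fun n ω => (E n ω : ℝ) / (c n : ℝ)) μ' Z hZmeas hconv
  have hti : ∀ δ n, Integrable (fun ω => min 1 |δ * ((E n ω : ℝ) / (c n : ℝ))|) μ := by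
    intro δ n
    have hm := hXm n
    refine (integrable_const (1 : ℝ)).mono' (Measurable.aestronglyMeasurable (by fun_prop))
      (ae_of_all _ fun ω => ?_)
    rw [Real.norm_eq_abs, abs_of_nonneg (by positivity)]
    exact min_le_left _ _
  constructor
  · intro k
    have hlim := hconv (poisF k)
    have e : ∫ ω, poisF k (Z ω) ∂μ' =
        ∫ ω, Real.exp (-(Z ω)) * Z ω ^ k / (Nat.factorial k : ℝ) ∂μ' := by
      refine integral_congr_ae ?_
      filter_upwards [hZ0] with ω h
      change poisW k |Z ω| = _
      rw [abs_of_nonneg h]; rfl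
    rw [e] at hlim
    have hdiff : Tendsto (fun n => (μ {ω | M n ω = k}).toReal -
        ∫ ω, poisF k ((E n ω : ℝ) / (c n : ℝ)) ∂μ) atTop (𝓝 0) := by
      rw [Metric.tendsto_nhds]
      intro η hη
      obtain ⟨δ, hδ, hev⟩ := htight η hη
      have hc2 : ∀ᶠ n in atTop, 2 * (1 / (c n : ℝ)) < δ := by
        have h1 : Tendsto (fun n => (c n : ℝ)) atTop atTop :=
          tendsto_natCast_atTop_atTop.comp hc
        have h2 := (h1.inv_tendsto_atTop).const_mul 2
        rw [mul_zero] at h2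
        simpa using h2.eventually (gt_mem_nhds hδ)
      filter_upwards [hev, hc2] with n h1 h2
      rw [Real.dist_eq, sub_zero]
      refine lt_of_le_of_lt ?_ h1
      rw [prob_M μ (1 / (c n : ℝ)) (hp0 n) (hp1 n) (E n) (M n) (hEmeas n) (hMmeas n) (hbin n) k]
      have i1 : Integrable (fun ω => binomPMF (E n ω) (1 / (c n : ℝ)) k) μ := by
        refine (integrable_const (1 : ℝ)).mono'
          ((measurable_from_top (f := fun m : ℕ => binomPMF m (1 / (c n : ℝ)) k)).comp
            (hEmeas n)).aestronglyMeasurable (ae_of_all _ fun ω => ?_)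
        rw [Real.norm_eq_abs, abs_of_nonneg (binomPMF_nonneg _ _ _ (hp0 n) (hp1 n))]
        exact binomPMF_le_one _ _ _ (hp0 n) (hp1 n)
      have i2 : Integrable (fun ω => poisF k ((E n ω : ℝ) / (c n : ℝ))) μ := by
        refine (integrable_const ‖poisF k‖).mono'
          ((poisF k).continuous.measurable.comp (hXm n)).aestronglyMeasurable
          (ae_of_all _ fun ω => (poisF k).norm_coe_le_norm _)
      rw [← integral_sub i1 i2]
      refine (abs_integral_le_integral_abs).trans ?_
      refine integral_mono (i1.sub i2).abs (hti δ n) fun ω => ?_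
      change |binomPMF (E n ω) (1 / (c n : ℝ)) k - poisW k (abs ((E n ω : ℝ) / (c n : ℝ)))| ≤ _
      have hx : 0 ≤ (E n ω : ℝ) / (c n : ℝ) := by positivity
      rw [abs_of_nonneg hx]
      refine le_min ?_ ?_
      · have a1 := binomPMF_nonneg (E n ω) _ k (hp0 n) (hp1 n)
        have a2 := binomPMF_le_one (E n ω) _ k (hp0 n) (hp1 n)
        have a3 := poisW_nonneg k _ hx
        have a4 := poisW_le_one k _ hx
        rw [abs_le]; constructor <;> linarith
      · rw [abs_of_nonneg (mul_nonneg hδ.le hx)]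
        have hb := binom_pois (1 / (c n : ℝ)) (hp0 n) (hp1 n) (E n ω) k
        rw [mul_one_div] at hb
        refine hb.trans ?_
        calc 2 * ((E n ω : ℝ) * (1 / (c n : ℝ)) ^ 2)
            = 2 * (1 / (c n : ℝ)) * ((E n ω : ℝ) / (c n : ℝ)) := by ring
          _ ≤ _ := by gcongr
    have := hdiff.add hlim
    simpa using this
  · intro t ε hε
    set P : ℕ → ℕ → ℝ := fun k n => (μ {ω | ε <
        |t ^ k / (Nat.factorial k : ℝ) *
          ((μ[fun ω => (M n ω : ℝ) ^ k | MeasurableSpace.comap (E n) inferInstance]) ω)|}).toReal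
      with hP
    have hP0 : ∀ k n, 0 ≤ P k n := fun k n => ENNReal.toReal_nonneg
    have hP1 : ∀ k n, P k n ≤ 1 := fun k n => measureReal_le_one
    have hbd : ∀ k, IsBoundedUnder (· ≤ ·) atTop (P k) := fun k =>
      isBoundedUnder_of ⟨1, hP1 k⟩
    have hbd' : ∀ k, IsBoundedUnder (· ≥ ·) atTop (P k) := fun k =>
      isBoundedUnder_of ⟨0, hP0 k⟩
    have hL0 : ∀ k, 0 ≤ limsup (P k) atTop := fun k =>
      le_limsup_of_frequently_le (Frequently.of_forall (hP0 k)) (hbd k)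
    have hL : ∀ η > 0, ∀ᶠ k in atTop, limsup (P k) atTop ≤ η := by
      intro η hη
      obtain ⟨δ, hδ, hev⟩ := htight η hη
      have hk : ∀ᶠ k : ℕ in atTop,
          (1 / 2 : ℝ) ^ k * Real.exp (1 / δ * Real.exp (2 * |t|)) < ε := by
        have h1 := (tendsto_pow_atTop_nhds_zero_of_lt_one (r := (1 / 2 : ℝ)) (by norm_num)
          (by norm_num)).mul_const (Real.exp (1 / δ * Real.exp (2 * |t|)))
        rw [zero_mul] at h1
        exact h1.eventually (gt_mem_nhds hε)
      filter_upwards [hk] with k hk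
      refine limsup_le_of_le (hbd' k).isCoboundedUnder_le ?_
      filter_upwards [hev] with n hn
      refine le_trans ?_ hn.le
      have hmk := mul_meas_ge_le_integral_of_nonneg (μ := μ)
        (f := fun ω => min 1 |δ * ((E n ω : ℝ) / (c n : ℝ))|)
        (ae_of_all _ fun ω => by positivity) (hti δ n) 1
      rw [one_mul] at hmk
      refine le_trans ?_ hmk
      refine ENNReal.toReal_mono (measure_ne_top _ _) (measure_mono_ae ?_)
      filter_upwards [condExp_M μ (1 / (c n : ℝ)) (hp0 n) (hp1 n) (E n) (M n) (hEmeas n)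
        (hMmeas n) (hbin n) k t] with ω hω hlt
      have hlt : ε < _ := hlt
      change 1 ≤ min 1 |δ * ((E n ω : ℝ) / (c n : ℝ))|
      have hx : 0 ≤ (E n ω : ℝ) / (c n : ℝ) := by positivity
      refine le_min le_rfl ?_
      rw [abs_of_nonneg (mul_nonneg hδ.le hx)]
      by_contra! hcon
      have hx2 : (E n ω : ℝ) / (c n : ℝ) ≤ 1 / δ := by
        rw [le_div_iff₀ hδ]; linarith
      have : (1 / 2 : ℝ) ^ k * Real.exp ((E n ω : ℝ) * (1 / (c n : ℝ)) * Real.exp (2 * |t|)) ≤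
          (1 / 2 : ℝ) ^ k * Real.exp (1 / δ * Real.exp (2 * |t|)) := by
        rw [mul_one_div]; gcongr
      linarith
    refine Tendsto.limsup_eq ?_
    rw [Metric.tendsto_nhds]
    intro η hη
    filter_upwards [hL (η / 2) (by positivity)] with k hk
    rw [Real.dist_eq, sub_zero, abs_of_nonneg (hL0 k)]
    linarith
end
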